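/- Let τ = (τ1, τ2) ∈ ℝ² with τ1 ≥ τ2 > 0 and τ1 + τ2 > 1, let B ⊆ [0,1]² be a ball of positive radius, let ε > 0, and let ρ = (ρ1, ρ2) ∈ ℚ² satisfy ρ1, ρ2 ≥ 1, ρ1 + ρ2 = 3, ρ1 ≥ ρ2, and 1 + τ_i − ρ_i > 0 for i = 1, 2. Then there exists a subset D ⊆ B ∩ B_2(Ψ_τ) such that dim_H D ≥ min{(3 + τ1 − τ2)/(1 + τ1), 3/(1 + τ2), 1 + ρ2/(1 + τ2)} − 2ε. -/

import Mathlib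

open MeasureTheory Set

noncomputable section

/-- The set of Ψ-approximable vectors in `[0,1]^m`: points `x` such that for infinitely many
positive integers `q` there exists `p ∈ ℤ^m` with `|q * x i - p i| < Ψ q i` for all `i`. -/
def approxSet (m : ℕ) (Ψ : ℕ → Fin m → ℝ) : Set (Fin m → ℝ) :=
  {x | (∀ i, x i ∈ Set.Icc (0:ℝ) 1) ∧
    {q : ℕ | 0 < q ∧ ∃ p : Fin m → ℤ,
      ∀ i, |(q : ℝ) * x i - (p i : ℝ)| < Ψ q i}.Infinite}

/-- The set of weighted Ψ-badly approximable vectors: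
`B_m(Ψ) = A_m(Ψ) \ ⋂_{0<c<1} A_m(cΨ)`. -/
def badSet (m : ℕ) (Ψ : ℕ → Fin m → ℝ) : Set (Fin m → ℝ) :=
  approxSet m Ψ \ ⋂ c ∈ Set.Ioo (0:ℝ) 1, approxSet m (fun q i => c * Ψ q i)

/-- The power-law approximation function `Ψ_τ`, with `ψ_i(q) = q^{-τ_i}`. -/
def psiTau (m : ℕ) (τ : Fin m → ℝ) : ℕ → Fin m → ℝ :=
  fun q i => (q : ℝ) ^ (-(τ i))

/-- The primes in the dyadic window `(Q, 2 Q]`. -/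
def dyadicPrimes (Q : ℕ) : Finset ℕ := (Finset.Ioc Q (2 * Q)).filter Nat.Prime

lemma mem_dyadicPrimes {Q q : ℕ} : q ∈ dyadicPrimes Q ↔ (Q < q ∧ q ≤ 2 * Q) ∧ q.Prime := by
  simp [dyadicPrimes]

lemma primeCounting_two_mul (Q : ℕ) :
    Nat.primeCounting (2 * Q) = Nat.primeCounting Q + (dyadicPrimes Q).card := by
  rw [← Nat.primesLE_card_eq_primeCounting, ← Nat.primesLE_card_eq_primeCounting,
    ← Finset.card_union_of_disjoint]
  · congr 1
    ext p
    simp only [Nat.mem_primesLE, Finset.mem_union, mem_dyadicPrimes]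
    constructor
    · rintro ⟨h1, h2⟩
      by_cases h : p ≤ Q
      · exact Or.inl ⟨h, h2⟩
      · exact Or.inr ⟨⟨by omega, h1⟩, h2⟩
    · rintro (⟨h1, h2⟩ | ⟨⟨h1, h3⟩, h2⟩)
      · exact ⟨by omega, h2⟩
      · exact ⟨h3, h2⟩
  · rw [Finset.disjoint_left]
    intro p hp hp'
    have := (Nat.mem_primesLE.1 hp).1
    have := (mem_dyadicPrimes.1 hp').1.1
    omega

/-- Infinitely many dyadic windows `(Q, 2 Q]` contain at least `Q^(1-η)` primes. -/
lemma frequently_dyadicPrimes {η : ℝ} (h0 : 0 < η) (h1 : η < 1) :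
    ∃ᶠ Q : ℕ in Filter.atTop, (Q : ℝ) ^ (1 - η) ≤ ((dyadicPrimes Q).card : ℝ) := by
  intro hcon
  obtain ⟨N, hN⟩ := Filter.eventually_atTop.1 hcon
  simp only [not_le] at hN
  set θ : ℝ := 2 ^ (1 - η) with hθ
  have hθ1 : 1 < θ := Real.one_lt_rpow (by norm_num) (by linarith)
  have hθ2 : θ < 2 := by
    calc θ < (2 : ℝ) ^ (1 : ℝ) := Real.rpow_lt_rpow_of_exponent_lt (by norm_num) (by linarith)
      _ = 2 := by simp
  set C : ℝ := max (1 / (θ - 1)) (Nat.primeCounting (2 ^ N)) with hC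
  have hC1 : 1 ≤ C * (θ - 1) := by
    have : 1 / (θ - 1) ≤ C := le_max_left _ _
    rwa [div_le_iff₀ (by linarith)] at this
  have hC0 : 0 ≤ C := le_trans (Nat.cast_nonneg _) (le_max_right _ _)
  have hpi : ∀ k : ℕ, N ≤ k → (Nat.primeCounting (2 ^ k) : ℝ) ≤ C * θ ^ k := by
    intro k hk
    induction k, hk using Nat.le_induction with
    | base =>
      calc (Nat.primeCounting (2 ^ N) : ℝ) ≤ C * 1 := by rw [mul_one]; exact le_max_right _ _
        _ ≤ C * θ ^ N := by gcongr; exact one_le_pow₀ hθ1.le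
    | succ k hk ih =>
      have hw : ((dyadicPrimes (2 ^ k)).card : ℝ) < θ ^ k := by
        have h2 : N ≤ 2 ^ k := hk.trans (Nat.lt_two_pow_self).le
        have := hN _ h2
        rwa [Nat.cast_pow, Nat.cast_ofNat, ← Real.rpow_natCast_mul (by norm_num), mul_comm,
          Real.rpow_mul_natCast (by norm_num)] at this
      rw [pow_succ' 2 k, primeCounting_two_mul, Nat.cast_add, pow_succ]
      have : 0 < θ ^ k := by positivity
      nlinarith
  have hlow : ∀ k : ℕ, 1 ≤ k → (2 : ℝ) ^ k - (k + 1) ≤ k * (Nat.primeCounting (2 ^ k) : ℝ) := by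
    intro k hk
    have h := Chebyshev.pi_ge (2 ^ k)
    have hl : (0 : ℝ) < Real.log 2 := Real.log_pos (by norm_num)
    have hk' : (1 : ℝ) ≤ k := by exact_mod_cast hk
    rw [Nat.cast_pow, Nat.cast_ofNat, Real.log_pow, div_le_iff₀ (by positivity)] at h
    have h3 : Real.log ((2 : ℝ) ^ k + 1) ≤ (k + 1) * Real.log 2 := by
      have : (k + 1 : ℝ) * Real.log 2 = Real.log (2 ^ (k + 1)) := by
        rw [Real.log_pow]; push_cast; ring
      rw [this]
      apply Real.log_le_log (by positivity)
      rw [pow_succ]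
      have : (1 : ℝ) ≤ 2 ^ k := one_le_pow₀ (by norm_num)
      linarith
    have h4 : ((2 : ℝ) ^ k - (k + 1)) * Real.log 2 ≤
        (k * (Nat.primeCounting (2 ^ k) : ℝ)) * Real.log 2 := by nlinarith
    exact le_of_mul_le_mul_right h4 hl
  have ht1 : Filter.Tendsto (fun k : ℕ => C * ((k : ℝ) * (θ / 2) ^ k) +
      2 * ((k : ℝ) * (1 / 2 : ℝ) ^ k)) Filter.atTop (nhds (C * 0 + 2 * 0)) := by
    apply Filter.Tendsto.add
    · exact (tendsto_self_mul_const_pow_of_lt_one (by positivity) (by linarith)).const_mul _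
    · exact (tendsto_self_mul_const_pow_of_lt_one (by positivity) (by norm_num)).const_mul _
  have hev := (ht1.eventually (gt_mem_nhds (show C * 0 + 2 * 0 < (1 : ℝ) by norm_num)))
  obtain ⟨k, hk, hk1, hkN⟩ := (hev.and ((Filter.eventually_ge_atTop 1).and
    (Filter.eventually_ge_atTop N))).exists
  have ha := hpi k hkN
  have hb := hlow k hk1
  have hk' : (1 : ℝ) ≤ k := by exact_mod_cast hk1
  have h2k : (0 : ℝ) < 2 ^ k := by positivity
  rw [div_pow, div_pow, one_pow] at hk
  have : (C * (k * θ ^ k) + 2 * k) < 2 ^ k := by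
    have := mul_lt_mul_of_pos_right hk h2k
    field_simp at this
    nlinarith
  nlinarith

/-- The nonzero integers of absolute value at most `v` number at most `2 * v`. -/
lemma card_ne_zero_abs_le (F : Finset ℤ) (v : ℝ) (hv : 0 ≤ v)
    (hF : ∀ k ∈ F, k ≠ 0 ∧ |(k : ℝ)| ≤ v) : (F.card : ℝ) ≤ 2 * v := by
  have hsub : F ⊆ (Finset.Icc (-⌊v⌋) ⌊v⌋).erase 0 := by
    intro k hk
    obtain ⟨h0, h1⟩ := hF k hk
    rw [abs_le] at h1
    rw [Finset.mem_erase, Finset.mem_Icc]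
    refine ⟨h0, ?_, ?_⟩
    · have : -k ≤ ⌊v⌋ := Int.le_floor.2 (by push_cast; linarith)
      linarith
    · exact Int.le_floor.2 h1.2
  have h := Finset.card_le_card hsub
  have hf : 0 ≤ ⌊v⌋ := Int.floor_nonneg.2 hv
  rw [Finset.card_erase_of_mem (by simp [hf]), Int.card_Icc] at h
  have h2 : (F.card : ℤ) ≤ 2 * ⌊v⌋ := by omega
  have h3 : (F.card : ℝ) ≤ 2 * (⌊v⌋ : ℝ) := by exact_mod_cast h2
  linarith [Int.floor_le v]

/-- Integers `p'` with `p' / q'` different from but close to `p / q`: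
those with `0 < |p' - q' p / q| ≤ u`. -/
def nearNum (q' q : ℕ) (p : ℤ) (u : ℝ) : Finset ℤ :=
  (Finset.Icc ⌈(q' * p / q : ℝ) - u⌉ ⌊(q' * p / q : ℝ) + u⌋).filter
    (fun p' => (p' : ℝ) ≠ q' * p / q)

lemma mem_nearNum {q' q : ℕ} {p : ℤ} {u : ℝ} {p' : ℤ} :
    p' ∈ nearNum q' q p u ↔ |(p' : ℝ) - q' * p / q| ≤ u ∧ (p' : ℝ) ≠ q' * p / q := by
  rw [nearNum, Finset.mem_filter, Finset.mem_Icc, Int.ceil_le, Int.le_floor, abs_le]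
  constructor
  · rintro ⟨⟨h1, h2⟩, h3⟩
    exact ⟨⟨by linarith, by linarith⟩, h3⟩
  · rintro ⟨⟨h1, h2⟩, h3⟩
    exact ⟨⟨by linarith, by linarith⟩, h3⟩

/-- On average over the fractions `p / q` of prime denominator `q`, the number of nearby fractions
with denominator `q'` is at most the expected one. -/
lemma sum_card_nearNum {q q' : ℕ} (hq : q.Prime) {u : ℝ} (hu : 0 ≤ u) :
    (∑ p ∈ Finset.Ioo (0 : ℤ) q, ((nearNum q' q p u).card : ℝ)) ≤ 2 * (q * u) := by
  have hq0 : (0 : ℝ) < q := by exact_mod_cast hq.pos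
  by_cases hdvd : q ∣ q'
  · obtain ⟨m, rfl⟩ := hdvd
    have hle : ∀ p ∈ Finset.Ioo (0 : ℤ) q, ((nearNum (q * m) q p u).card : ℝ) ≤ 2 * u := by
      intro p _
      have hinj : Function.Injective (fun p' : ℤ => p' - m * p) := fun a b h => by simpa using h
      rw [← Finset.card_image_of_injective _ hinj]
      apply card_ne_zero_abs_le _ _ hu
      intro k hk
      obtain ⟨p', hp', rfl⟩ := Finset.mem_image.1 hk
      rw [mem_nearNum] at hp'
      have he : (((q * m : ℕ) : ℝ) * p / q) = m * p := by push_cast; field_simp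
      rw [he] at hp'
      refine ⟨?_, by push_cast; exact hp'.1⟩
      intro h0
      apply hp'.2
      have : p' = m * p := by linarith
      rw [this]; push_cast; ring
    calc (∑ p ∈ Finset.Ioo (0 : ℤ) q, ((nearNum (q * m) q p u).card : ℝ))
        ≤ ∑ p ∈ Finset.Ioo (0 : ℤ) q, 2 * u := Finset.sum_le_sum hle
      _ = ((q - 1 : ℕ) : ℝ) * (2 * u) := by
        rw [Finset.sum_const, Int.card_Ioo, nsmul_eq_mul]
        congr 2
        omega
      _ ≤ q * (2 * u) := by
        gcongr
        exact Nat.sub_le _ _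
      _ = 2 * (q * u) := by ring
  · have hcop : IsCoprime (q : ℤ) (q' : ℤ) :=
      Nat.isCoprime_iff_coprime.2 ((Nat.Prime.coprime_iff_not_dvd hq).2 hdvd)
    rw [← Nat.cast_sum, ← Finset.card_sigma]
    have hinj : Set.InjOn (fun z : (_ : ℤ) × ℤ => (q' : ℤ) * z.1 - q * z.2)
        ((Finset.Ioo (0 : ℤ) q).sigma fun p => nearNum q' q p u : Finset _) := by
      rintro ⟨a, a'⟩ ha ⟨b, b'⟩ hb hab
      simp only [Finset.coe_sigma, Set.mem_sigma_iff, Finset.mem_coe, Finset.mem_Ioo] at ha hb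
      simp only at hab
      have hd : (q : ℤ) ∣ q' * (a - b) := ⟨a' - b', by linarith⟩
      have hd2 : (q : ℤ) ∣ a - b := hcop.dvd_of_dvd_mul_left hd
      have hab0 : a - b = 0 := by
        apply Int.eq_zero_of_abs_lt_dvd hd2
        rw [abs_lt]; constructor <;> linarith [ha.1.1, ha.1.2, hb.1.1, hb.1.2]
      have hab1 : a = b := by linarith
      subst hab1
      have : (q : ℤ) * a' = q * b' := by linarith
      have : a' = b' := by
        have hqz : (q : ℤ) ≠ 0 := by exact_mod_cast hq.ne_zero
        exact mul_left_cancel₀ hqz this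
      rw [this]
    rw [← Finset.card_image_of_injOn hinj]
    apply card_ne_zero_abs_le _ _ (by positivity)
    intro k hk
    obtain ⟨⟨p, p'⟩, hz, rfl⟩ := Finset.mem_image.1 hk
    rw [Finset.mem_sigma, mem_nearNum] at hz
    obtain ⟨-, h1, h2⟩ := hz
    simp only at h1 h2 ⊢
    have key : (((q' : ℤ) * p - q * p' : ℤ) : ℝ) = -(q * ((p' : ℝ) - q' * p / q)) := by
      push_cast; field_simp; ring
    constructor
    · intro h0
      rw [h0] at key
      apply h2
      have : (q : ℝ) * ((p' : ℝ) - q' * p / q) = 0 := by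
        rw [Int.cast_zero] at key; linarith
      rcases mul_eq_zero.1 this with h | h
      · exact absurd h hq0.ne'
      · linarith
    · rw [key, abs_neg, abs_mul, abs_of_pos hq0]
      gcongr

/-- The numerators `p` of fractions `p / q` in `[b, b + l]` number at most `q l + 1`. -/
lemma card_num_le {q : ℕ} (hq : 0 < q) {b l : ℝ} (hl : 0 ≤ l) (F : Finset ℤ)
    (hF : ∀ p ∈ F, b ≤ (p : ℝ) / q ∧ (p : ℝ) / q ≤ b + l) : (F.card : ℝ) ≤ q * l + 1 := by
  have hq0 : (0 : ℝ) < q := by exact_mod_cast hq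
  have hsub : F ⊆ Finset.Icc ⌈b * q⌉ ⌊(b + l) * q⌋ := by
    intro p hp
    obtain ⟨h1, h2⟩ := hF p hp
    rw [le_div_iff₀ hq0] at h1
    rw [div_le_iff₀ hq0] at h2
    exact Finset.mem_Icc.2 ⟨Int.ceil_le.2 h1, Int.le_floor.2 h2⟩
  have h := Finset.card_le_card hsub
  rw [Int.card_Icc] at h
  have h2 : (F.card : ℝ) ≤ ((⌊(b + l) * q⌋ + 1 - ⌈b * q⌉).toNat : ℝ) := by exact_mod_cast h
  refine h2.trans ?_
  have h3 : (((⌊(b + l) * q⌋ + 1 - ⌈b * q⌉).toNat : ℤ) : ℝ) ≤ q * l + 1 := by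
    rcases le_total 0 (⌊(b + l) * q⌋ + 1 - ⌈b * q⌉) with h | h
    · rw [Int.toNat_of_nonneg h]
      push_cast
      linarith [Int.floor_le ((b + l) * q), Int.le_ceil (b * q)]
    · rw [Int.toNat_of_nonpos h]
      push_cast
      positivity
  exact_mod_cast h3

/-- The numerators `p` of fractions `p / q` in `[b, b + l]`. -/
def numIn (q : ℕ) (b l : ℝ) : Finset ℤ := Finset.Icc ⌈b * q⌉ ⌊(b + l) * q⌋

lemma mem_numIn {q : ℕ} (hq : 0 < q) {b l : ℝ} {p : ℤ} :
    p ∈ numIn q b l ↔ b ≤ (p : ℝ) / q ∧ (p : ℝ) / q ≤ b + l := by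
  have hq0 : (0 : ℝ) < q := by exact_mod_cast hq
  rw [numIn, Finset.mem_Icc, Int.ceil_le, Int.le_floor, le_div_iff₀ hq0, div_le_iff₀ hq0]

lemma le_card_numIn (q : ℕ) (b l : ℝ) : q * l - 1 ≤ ((numIn q b l).card : ℝ) := by
  rw [numIn, Int.card_Icc]
  have h3 : q * l - 1 ≤ (((⌊(b + l) * q⌋ + 1 - ⌈b * q⌉).toNat : ℤ) : ℝ) := by
    have : ((⌊(b + l) * q⌋ + 1 - ⌈b * q⌉ : ℤ) : ℝ) ≤
        (((⌊(b + l) * q⌋ + 1 - ⌈b * q⌉).toNat : ℤ) : ℝ) := by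
      exact_mod_cast Int.self_le_toNat _
    refine le_trans ?_ this
    push_cast
    linarith [Int.lt_floor_add_one ((b + l) * q), Int.ceil_lt_add_one (b * q)]
  exact_mod_cast h3

/-- The tail `∑_{n ≥ T} n^(-e)`. -/
def powTail (e : ℝ) (T : ℕ) : ℝ := ∑' n : ℕ, ((n + T : ℕ) : ℝ) ^ (-e)

lemma powTail_tendsto (e : ℝ) : Filter.Tendsto (powTail e) Filter.atTop (nhds 0) :=
  _root_.tendsto_sum_nat_add (fun n : ℕ => (n : ℝ) ^ (-e))

lemma sum_Ico_le_powTail {e : ℝ} (he : 1 < e) (T M : ℕ) :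
    ∑ q ∈ Finset.Ico T M, (q : ℝ) ^ (-e) ≤ powTail e T := by
  have hs : Summable (fun n : ℕ => (n : ℝ) ^ (-e)) := Real.summable_nat_rpow.2 (by linarith)
  have hs' : Summable (fun n : ℕ => ((n + T : ℕ) : ℝ) ^ (-e)) := (summable_nat_add_iff T).2 hs
  rw [Finset.sum_Ico_eq_sum_range]
  have := hs'.sum_le_tsum (Finset.range (M - T)) (fun n _ => by positivity)
  refine le_trans (le_of_eq ?_) this
  apply Finset.sum_congr rfl
  intro n _
  rw [add_comm]

/-- Markov's inequality for finite sums. -/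
lemma card_filter_lt_le {α : Type*} (V : Finset α) (f : α → ℝ) (hf : ∀ x ∈ V, 0 ≤ f x) {t S : ℝ}
    (ht : 0 < t) (hS : ∑ x ∈ V, f x ≤ S) : ((V.filter (fun x => t < f x)).card : ℝ) ≤ S / t := by
  rw [le_div_iff₀ ht, ← nsmul_eq_mul]
  calc (V.filter (fun x => t < f x)).card • t
      ≤ ∑ x ∈ V.filter (fun x => t < f x), f x :=
        Finset.card_nsmul_le_sum _ _ _ (fun x hx => (Finset.mem_filter.1 hx).2.le)
    _ ≤ ∑ x ∈ V, f x :=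
        Finset.sum_le_sum_of_subset_of_nonneg (Finset.filter_subset _ _) (fun x hx _ => hf x hx)
    _ ≤ S := hS

/-- Numerators of rational points with denominator `q` in the open unit square. -/
def unitNum (q : ℕ) : Finset (ℤ × ℤ) := Finset.Ioo (0 : ℤ) q ×ˢ Finset.Ioo (0 : ℤ) q

/-- The number of rational points with denominator `q'` near `p / q`, sharing no coordinate
with it. -/
def nearCount (q' q : ℕ) (p : ℤ × ℤ) (u₁ u₂ : ℝ) : ℝ :=
  ((nearNum q' q p.1 u₁).card : ℝ) * ((nearNum q' q p.2 u₂).card : ℝ)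

lemma nearCount_nonneg (q' q : ℕ) (p : ℤ × ℤ) (u₁ u₂ : ℝ) : 0 ≤ nearCount q' q p u₁ u₂ := by
  unfold nearCount; positivity

lemma sum_nearCount {q q' : ℕ} (hq : q.Prime) {u₁ u₂ : ℝ} (h₁ : 0 ≤ u₁) (h₂ : 0 ≤ u₂) :
    ∑ p ∈ unitNum q, nearCount q' q p u₁ u₂ ≤ 4 * (q ^ 2 * (u₁ * u₂)) := by
  unfold unitNum nearCount
  rw [Finset.sum_product]
  simp only
  rw [← Finset.sum_mul_sum]
  calc _ ≤ (2 * (q * u₁)) * (2 * (q * u₂)) :=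
        mul_le_mul (sum_card_nearNum hq h₁) (sum_card_nearNum hq h₂) (by positivity)
          (by positivity)
    _ = _ := by ring

/-- The scale `(2 Q)^(-a)` of the boxes around rational points with denominator in `(Q, 2 Q]`. -/
def width (a : ℝ) (Q : ℕ) : ℝ := (2 * Q : ℝ) ^ (-a)

lemma width_pos (a : ℝ) {Q : ℕ} (hQ : 0 < Q) : 0 < width a Q := by
  unfold width; positivity

/-- Weighted number of rational points of denominator in `[q, T)` near `p / q`. -/
def futureWeight (a₁ a₂ : ℝ) (Q T q : ℕ) (p : ℤ × ℤ) : ℝ :=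
  ∑ k ∈ Finset.Ico q T, (k : ℝ) ^ (-(a₁ + a₂)) *
    nearCount k q p (2 * width a₁ Q * k) (2 * width a₂ Q * k)

/-- Number of rational points of denominator in `[T, q)` too close to `p / q`. -/
def pastCount (a₁ a₂ : ℝ) (T q : ℕ) (p : ℤ × ℤ) : ℝ :=
  ∑ k ∈ Finset.Ico T q,
    nearCount k q p (2 * ((k : ℝ) ^ (-a₁) * k)) (2 * ((k : ℝ) ^ (-a₂) * k))

/-- Number of neighbours of `p / q` with a different denominator in the same dyadic window. -/
def crowd (Q : ℕ) (R₁ R₂ : ℝ) (q : ℕ) (p : ℤ × ℤ) : ℝ :=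
  ∑ k ∈ (dyadicPrimes Q).erase q, nearCount k q p (3 * R₁ * k) (3 * R₂ * k)

lemma futureWeight_nonneg (a₁ a₂ : ℝ) (Q T q : ℕ) (p : ℤ × ℤ) :
    0 ≤ futureWeight a₁ a₂ Q T q p :=
  Finset.sum_nonneg fun _ _ => mul_nonneg (by positivity) (nearCount_nonneg _ _ _ _ _)

lemma pastCount_nonneg (a₁ a₂ : ℝ) (T q : ℕ) (p : ℤ × ℤ) : 0 ≤ pastCount a₁ a₂ T q p :=
  Finset.sum_nonneg fun _ _ => nearCount_nonneg _ _ _ _ _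

lemma crowd_nonneg (Q : ℕ) (R₁ R₂ : ℝ) (q : ℕ) (p : ℤ × ℤ) : 0 ≤ crowd Q R₁ R₂ q p :=
  Finset.sum_nonneg fun _ _ => nearCount_nonneg _ _ _ _ _

lemma rpow_mul_sq {a₁ a₂ : ℝ} {n : ℕ} (hn : 0 < n) :
    (n : ℝ) ^ (-(a₁ + a₂)) * (n : ℝ) ^ 2 = (n : ℝ) ^ (-(a₁ + a₂ - 2)) := by
  have hn' : (0 : ℝ) < n := by exact_mod_cast hn
  rw [← Real.rpow_natCast, ← Real.rpow_add hn']
  congr 1; push_cast; ring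

lemma sum_futureWeight {a₁ a₂ : ℝ} (ha : 3 < a₁ + a₂) {Q T q : ℕ} (hq : q.Prime) (hQ : 0 < Q)
    (hQq : Q < q) :
    ∑ p ∈ unitNum q, futureWeight a₁ a₂ Q T q p ≤
      16 * q ^ 2 * (width a₁ Q * width a₂ Q) * powTail (a₁ + a₂ - 2) Q := by
  have hw₁ := width_pos a₁ hQ
  have hw₂ := width_pos a₂ hQ
  unfold futureWeight
  rw [Finset.sum_comm]
  calc _ ≤ ∑ q' ∈ Finset.Ico q T,
        16 * q ^ 2 * (width a₁ Q * width a₂ Q) * (q' : ℝ) ^ (-(a₁ + a₂ - 2)) := by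
        apply Finset.sum_le_sum
        intro q' hq'
        have hq'0 : 0 < q' := lt_of_lt_of_le hq.pos (Finset.mem_Ico.1 hq').1
        rw [← Finset.mul_sum, ← rpow_mul_sq hq'0]
        calc _ ≤ (q' : ℝ) ^ (-(a₁ + a₂)) *
              (4 * (q ^ 2 * ((2 * width a₁ Q * q') * (2 * width a₂ Q * q')))) := by
              gcongr
              exact sum_nearCount hq (by positivity) (by positivity)
          _ = _ := by ring
    _ = 16 * q ^ 2 * (width a₁ Q * width a₂ Q) *
        ∑ q' ∈ Finset.Ico q T, (q' : ℝ) ^ (-(a₁ + a₂ - 2)) := by rw [Finset.mul_sum]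
    _ ≤ 16 * q ^ 2 * (width a₁ Q * width a₂ Q) *
        ∑ q' ∈ Finset.Ico Q T, (q' : ℝ) ^ (-(a₁ + a₂ - 2)) := by
        gcongr
    _ ≤ _ := by
        gcongr
        exact sum_Ico_le_powTail (by linarith) _ _

lemma sum_pastCount {a₁ a₂ : ℝ} (ha : 3 < a₁ + a₂) {T q : ℕ} (hq : q.Prime) (hT : 0 < T) :
    ∑ p ∈ unitNum q, pastCount a₁ a₂ T q p ≤ 16 * q ^ 2 * powTail (a₁ + a₂ - 2) T := by
  unfold pastCount
  rw [Finset.sum_comm]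
  calc _ ≤ ∑ q' ∈ Finset.Ico T q, 16 * q ^ 2 * (q' : ℝ) ^ (-(a₁ + a₂ - 2)) := by
        apply Finset.sum_le_sum
        intro q' hq'
        have hq'0 : 0 < q' := lt_of_lt_of_le hT (Finset.mem_Ico.1 hq').1
        have hq'1 : (0 : ℝ) < q' := by exact_mod_cast hq'0
        refine (sum_nearCount hq (by positivity) (by positivity)).trans (le_of_eq ?_)
        rw [← rpow_mul_sq hq'0, neg_add, Real.rpow_add hq'1]
        ring
    _ = 16 * q ^ 2 * ∑ q' ∈ Finset.Ico T q, (q' : ℝ) ^ (-(a₁ + a₂ - 2)) := by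
        rw [Finset.mul_sum]
    _ ≤ _ := by
        gcongr
        exact sum_Ico_le_powTail (by linarith) _ _

lemma sum_crowd {Q q : ℕ} (hq : q.Prime) {R₁ R₂ : ℝ} (h₁ : 0 ≤ R₁) (h₂ : 0 ≤ R₂) :
    ∑ p ∈ unitNum q, crowd Q R₁ R₂ q p ≤ 144 * q ^ 2 * (Q ^ 3 * (R₁ * R₂)) := by
  unfold crowd
  rw [Finset.sum_comm]
  have hc : (dyadicPrimes Q).card ≤ Q := by
    refine (Finset.card_filter_le _ _).trans ?_
    rw [Nat.card_Ioc]; omega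
  calc _ ≤ ∑ q' ∈ (dyadicPrimes Q).erase q, 144 * q ^ 2 * (Q ^ 2 * (R₁ * R₂)) := by
        apply Finset.sum_le_sum
        intro q' hq'
        have hq'2 : (q' : ℝ) ≤ 2 * Q := by
          exact_mod_cast (mem_dyadicPrimes.1 (Finset.mem_of_mem_erase hq')).1.2
        refine (sum_nearCount hq (by positivity) (by positivity)).trans ?_
        calc 4 * ((q : ℝ) ^ 2 * (3 * R₁ * q' * (3 * R₂ * q')))
            ≤ 4 * ((q : ℝ) ^ 2 * (3 * R₁ * (2 * Q) * (3 * R₂ * (2 * Q)))) := by gcongr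
          _ = _ := by ring
    _ = ((dyadicPrimes Q).erase q).card * (144 * q ^ 2 * (Q ^ 2 * (R₁ * R₂))) := by
        rw [Finset.sum_const, nsmul_eq_mul]
    _ ≤ Q * (144 * q ^ 2 * (Q ^ 2 * (R₁ * R₂))) := by
        gcongr
        exact (Finset.card_le_card (Finset.erase_subset _ _)).trans hc
    _ = _ := by ring

/-- A planar box given by its lower left corner and its side lengths. -/
structure Box where
  b₁ : ℝ
  l₁ : ℝ
  b₂ : ℝ
  l₂ : ℝ

/-- The points of a box. -/
def Box.toSet (R : Box) : Set (Fin 2 → ℝ) :=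
  {y | (R.b₁ ≤ y 0 ∧ y 0 ≤ R.b₁ + R.l₁) ∧ (R.b₂ ≤ y 1 ∧ y 1 ≤ R.b₂ + R.l₂)}

/-- A rational point in the plane, as a denominator and a pair of numerators. -/
abbrev RatPt := (_ : ℕ) × (ℤ × ℤ)

/-- `y` lies within `c q^(-aᵢ)` of the rational point `z` with denominator `q`. -/
def Hit (c a₁ a₂ : ℝ) (z : RatPt) (y : Fin 2 → ℝ) : Prop :=
  |y 0 - z.2.1 / z.1| < c * (z.1 : ℝ) ^ (-a₁) ∧ |y 1 - z.2.2 / z.1| < c * (z.1 : ℝ) ^ (-a₂)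

/-- A box inside the unit square in which rational points of denominator at least `q₀`
cause little obstruction: those in `[q₀, T)` are controlled by the list `N`, those beyond `T` by
the tail bound. -/
structure Fertile (c a₁ a₂ : ℝ) (R : Box) (q₀ T : ℕ) (N : Finset RatPt) : Prop where
  b₁_pos : 0 < R.b₁
  b₂_pos : 0 < R.b₂
  l₁_pos : 0 < R.l₁
  l₂_pos : 0 < R.l₂
  lt_one₁ : R.b₁ + R.l₁ < 1
  lt_one₂ : R.b₂ + R.l₂ < 1
  q₀_pos : 0 < q₀
  le_T : q₀ ≤ T
  tail_le : powTail (a₁ + a₂ - 2) T ≤ R.l₁ * R.l₂ / 4096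
  mem_N : ∀ z ∈ N, 0 < z.1 ∧ z.1 < T
  sum_le : ∑ z ∈ N, (z.1 : ℝ) ^ (-(a₁ + a₂)) ≤ R.l₁ * R.l₂ / 3200
  avoid : ∀ z : RatPt, q₀ ≤ z.1 → z.1 < T → z ∉ N → ∀ y ∈ R.toSet, ¬ Hit c a₁ a₂ z y

/-- The scales at which crowding is controlled. -/
def gridScale (η a : ℝ) (Q k : ℕ) : ℝ := max ((Q : ℝ) ^ (-1 - η * k)) (width a Q)

/-- Closeness of `p / q` to a rational point of the list `N`. -/
def NearList (a₁ a₂ : ℝ) (N : Finset RatPt) (q : ℕ) (p : ℤ × ℤ) : Prop :=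
  ∃ z ∈ N, |(p.1 : ℝ) / q - z.2.1 / z.1| ≤ 2 * (z.1 : ℝ) ^ (-a₁) ∧
    |(p.2 : ℝ) / q - z.2.2 / z.1| ≤ 2 * (z.1 : ℝ) ^ (-a₂)

/-- The conditions a rational point `p / q` in a box has to satisfy to be used at the next level. -/
structure Selected (a₁ a₂ η : ℝ) (K : ℕ) (R : Box) (T : ℕ) (N : Finset RatPt) (Q T' q : ℕ)
    (p : ℤ × ℤ) : Prop where
  mem₁ : R.b₁ ≤ (p.1 : ℝ) / q ∧ (p.1 : ℝ) / q ≤ R.b₁ + R.l₁ / 2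
  mem₂ : R.b₂ ≤ (p.2 : ℝ) / q ∧ (p.2 : ℝ) / q ≤ R.b₂ + R.l₂ / 2
  mem_unit : p ∈ unitNum q
  not_near : ¬ NearList a₁ a₂ N q p
  past : pastCount a₁ a₂ T q p ≤ 1 / 2
  future : futureWeight a₁ a₂ Q T' q p ≤ width a₁ Q * width a₂ Q / 51200
  crowd_le : ∀ k < K, crowd Q (gridScale η a₁ Q k) (gridScale η a₂ Q k) q p ≤
    (Q : ℝ) ^ (3 + η) * (gridScale η a₁ Q k * gridScale η a₂ Q k)

lemma card_nearList_le {a₁ a₂ : ℝ} {q : ℕ} (hq : 0 < q) (C : Finset (ℤ × ℤ)) (N : Finset RatPt)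
    (hN : ∀ z ∈ N, 0 < z.1 ∧ 1 ≤ (q : ℝ) * (z.1 : ℝ) ^ (-a₁) ∧ 1 ≤ (q : ℝ) * (z.1 : ℝ) ^ (-a₂))
    (hC : ∀ p ∈ C, NearList a₁ a₂ N q p) :
    (C.card : ℝ) ≤ 25 * q ^ 2 * ∑ z ∈ N, (z.1 : ℝ) ^ (-(a₁ + a₂)) := by
  classical
  set I : RatPt → Finset (ℤ × ℤ) := fun z =>
    numIn q (z.2.1 / z.1 - 2 * (z.1 : ℝ) ^ (-a₁)) (4 * (z.1 : ℝ) ^ (-a₁)) ×ˢ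
    numIn q (z.2.2 / z.1 - 2 * (z.1 : ℝ) ^ (-a₂)) (4 * (z.1 : ℝ) ^ (-a₂)) with hI
  have hsub : C ⊆ N.biUnion I := by
    intro p hp
    obtain ⟨z, hz, h1, h2⟩ := hC p hp
    rw [abs_le] at h1 h2
    rw [Finset.mem_biUnion]
    refine ⟨z, hz, ?_⟩
    rw [hI, Finset.mem_product, mem_numIn hq, mem_numIn hq]
    refine ⟨⟨by linarith, by linarith⟩, ⟨by linarith, by linarith⟩⟩
  have h1 : (C.card : ℝ) ≤ ∑ z ∈ N, ((I z).card : ℝ) := by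
    exact_mod_cast (Finset.card_le_card hsub).trans Finset.card_biUnion_le
  refine h1.trans ?_
  rw [Finset.mul_sum]
  apply Finset.sum_le_sum
  intro z hz
  obtain ⟨h0, h2, h3⟩ := hN z hz
  have h0' : (0 : ℝ) < z.1 := by exact_mod_cast h0
  have key : ∀ (b a : ℝ), 1 ≤ (q : ℝ) * (z.1 : ℝ) ^ (-a) →
      ((numIn q b (4 * (z.1 : ℝ) ^ (-a))).card : ℝ) ≤ 5 * (q * (z.1 : ℝ) ^ (-a)) := by
    intro b a h
    have := card_num_le hq (b := b) (l := 4 * (z.1 : ℝ) ^ (-a)) (by positivity) _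
      (fun p hp => (mem_numIn hq).1 hp)
    linarith
  rw [hI, Finset.card_product, Nat.cast_mul, neg_add, Real.rpow_add h0']
  calc _ ≤ (5 * (q * (z.1 : ℝ) ^ (-a₁))) * (5 * (q * (z.1 : ℝ) ^ (-a₂))) := by
        gcongr
        · exact key _ _ h2
        · exact key _ _ h3
    _ = _ := by ring

lemma gridScale_pos (η a : ℝ) {Q : ℕ} (hQ : 0 < Q) (k : ℕ) : 0 < gridScale η a Q k :=
  lt_max_of_lt_right (width_pos a hQ)

/-- In a fertile box, a positive proportion of the rational points with a given large prime
denominator are selected. -/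
lemma exists_selected {c a₁ a₂ η : ℝ} (ha : 3 < a₁ + a₂) (h₁ : 0 < a₁) (h₂ : 0 < a₂) (hη : 0 < η)
    (K : ℕ) {R : Box} {q₀ T : ℕ} {N : Finset RatPt} (hR : Fertile c a₁ a₂ R q₀ T N) :
    ∀ᶠ Q : ℕ in Filter.atTop, ∀ T' q : ℕ, q ∈ dyadicPrimes Q →
      ∃ G : Finset (ℤ × ℤ), q ^ 2 * (R.l₁ * R.l₂) / 32 ≤ (G.card : ℝ) ∧
        ∀ p ∈ G, Selected a₁ a₂ η K R T N Q T' q p := by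
  classical
  have hl₁ := hR.l₁_pos
  have hl₂ := hR.l₂_pos
  have hll : 0 < R.l₁ * R.l₂ := mul_pos hl₁ hl₂
  have hcast : Filter.Tendsto (fun Q : ℕ => (Q : ℝ)) Filter.atTop Filter.atTop :=
    tendsto_natCast_atTop_atTop
  have e1 : ∀ᶠ Q : ℕ in Filter.atTop, 4 / R.l₁ ≤ (Q : ℝ) := hcast.eventually_ge_atTop _
  have e2 : ∀ᶠ Q : ℕ in Filter.atTop, 4 / R.l₂ ≤ (Q : ℝ) := hcast.eventually_ge_atTop _
  have e3 : ∀ᶠ Q : ℕ in Filter.atTop, (T : ℝ) ^ a₁ ≤ (Q : ℝ) := hcast.eventually_ge_atTop _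
  have e4 : ∀ᶠ Q : ℕ in Filter.atTop, (T : ℝ) ^ a₂ ≤ (Q : ℝ) := hcast.eventually_ge_atTop _
  have e5 : ∀ᶠ Q : ℕ in Filter.atTop,
      powTail (a₁ + a₂ - 2) Q < R.l₁ * R.l₂ / (128 * 16 * 51200) :=
    (powTail_tendsto _).eventually (gt_mem_nhds (by positivity))
  have e6 : ∀ᶠ Q : ℕ in Filter.atTop, (Q : ℝ) ^ (-η) < R.l₁ * R.l₂ / (128 * 144 * (K + 1)) :=
    ((tendsto_rpow_neg_atTop hη).comp hcast).eventually (gt_mem_nhds (by positivity))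
  filter_upwards [e1, e2, e3, e4, e5, e6, Filter.eventually_gt_atTop 0] with Q e1 e2 e3 e4 e5 e6 hQ
  intro T' q hqQ
  obtain ⟨⟨hQq, hq2⟩, hq⟩ := mem_dyadicPrimes.1 hqQ
  have hQ0 : (0 : ℝ) < Q := by exact_mod_cast hQ
  have hq0 : (0 : ℝ) < q := by exact_mod_cast hq.pos
  have hQqr : (Q : ℝ) ≤ q := by exact_mod_cast hQq.le
  have hw₁ := width_pos a₁ hQ
  have hw₂ := width_pos a₂ hQ
  set C := numIn q R.b₁ (R.l₁ / 2) ×ˢ numIn q R.b₂ (R.l₂ / 2) with hC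
  have hCmem : ∀ p ∈ C, (R.b₁ ≤ (p.1 : ℝ) / q ∧ (p.1 : ℝ) / q ≤ R.b₁ + R.l₁ / 2) ∧
      (R.b₂ ≤ (p.2 : ℝ) / q ∧ (p.2 : ℝ) / q ≤ R.b₂ + R.l₂ / 2) := by
    intro p hp
    rw [hC, Finset.mem_product, mem_numIn hq.pos, mem_numIn hq.pos] at hp
    exact hp
  have hunit : ∀ (b l : ℝ) (p : ℤ), 0 < b → 0 < l → b + l < 1 → b ≤ (p : ℝ) / q →
      (p : ℝ) / q ≤ b + l / 2 → p ∈ Finset.Ioo (0 : ℤ) q := by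
    intro b l p hb hl hbl h1 h2
    have h3 : 0 < (p : ℝ) / q := by linarith
    have h4 : (p : ℝ) / q < 1 := by linarith
    rw [div_lt_one hq0] at h4
    rw [Finset.mem_Ioo]
    refine ⟨?_, by exact_mod_cast h4⟩
    have : (0 : ℝ) < p := by
      have := mul_pos h3 hq0
      rwa [div_mul_cancel₀ _ hq0.ne'] at this
    exact_mod_cast this
  have hCV : C ⊆ unitNum q := by
    intro p hp
    obtain ⟨⟨h1, h2⟩, h3, h4⟩ := hCmem p hp
    rw [unitNum, Finset.mem_product]
    exact ⟨hunit _ _ _ hR.b₁_pos hl₁ hR.lt_one₁ h1 h2, hunit _ _ _ hR.b₂_pos hl₂ hR.lt_one₂ h3 h4⟩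
  have hCcard : q ^ 2 * (R.l₁ * R.l₂) / 16 ≤ (C.card : ℝ) := by
    have key : ∀ b l : ℝ, 0 < l → 4 / l ≤ (Q : ℝ) → q * l / 4 ≤ ((numIn q b (l / 2)).card : ℝ) := by
      intro b l hl h
      have h1 := le_card_numIn q b (l / 2)
      rw [div_le_iff₀ hl] at h
      have : (Q : ℝ) * l ≤ q * l := by gcongr
      linarith
    rw [hC, Finset.card_product, Nat.cast_mul]
    calc _ = (q * R.l₁ / 4) * (q * R.l₂ / 4) := by ring
      _ ≤ _ := by
        gcongr
        · exact key _ _ hl₁ e1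
        · exact key _ _ hl₂ e2
  set B₁ := C.filter (fun p => NearList a₁ a₂ N q p) with hB₁
  set B₂ := (unitNum q).filter (fun p => 1 / 2 < pastCount a₁ a₂ T q p) with hB₂
  set B₃ := (unitNum q).filter
    (fun p => width a₁ Q * width a₂ Q / 51200 < futureWeight a₁ a₂ Q T' q p) with hB₃
  set B₄ : ℕ → Finset (ℤ × ℤ) := fun k => (unitNum q).filter
    (fun p => (Q : ℝ) ^ (3 + η) * (gridScale η a₁ Q k * gridScale η a₂ Q k) <
      crowd Q (gridScale η a₁ Q k) (gridScale η a₂ Q k) q p) with hB₄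
  have c1 : (B₁.card : ℝ) ≤ q ^ 2 * (R.l₁ * R.l₂) / 128 := by
    have hz : ∀ a : ℝ, 0 < a → (T : ℝ) ^ a ≤ Q → ∀ z ∈ N, 1 ≤ (q : ℝ) * (z.1 : ℝ) ^ (-a) := by
      intro a ha hT z hz
      obtain ⟨hz1, hz2⟩ := hR.mem_N z hz
      have hz1' : (0 : ℝ) < z.1 := by exact_mod_cast hz1
      have hz2' : (z.1 : ℝ) ≤ T := by exact_mod_cast hz2.le
      rw [Real.rpow_neg hz1'.le, ← div_eq_mul_inv, one_le_div (by positivity)]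
      calc (z.1 : ℝ) ^ a ≤ (T : ℝ) ^ a := by gcongr
        _ ≤ q := hT.trans hQqr
    have := card_nearList_le hq.pos B₁ N
      (fun z hz' => ⟨(hR.mem_N z hz').1, hz a₁ h₁ e3 z hz', hz a₂ h₂ e4 z hz'⟩)
      (fun p hp => (Finset.mem_filter.1 hp).2)
    calc (B₁.card : ℝ) ≤ _ := this
      _ ≤ 25 * q ^ 2 * (R.l₁ * R.l₂ / 3200) := by gcongr; exact hR.sum_le
      _ = _ := by ring
  have c2 : (B₂.card : ℝ) ≤ q ^ 2 * (R.l₁ * R.l₂) / 128 := by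
    have := card_filter_lt_le (unitNum q) (fun p => pastCount a₁ a₂ T q p)
      (fun p _ => pastCount_nonneg _ _ _ _ _) (t := 1 / 2) (by norm_num)
      (sum_pastCount ha hq (lt_of_lt_of_le hR.q₀_pos hR.le_T))
    calc (B₂.card : ℝ) ≤ _ := this
      _ ≤ 16 * q ^ 2 * (R.l₁ * R.l₂ / 4096) / (1 / 2) := by gcongr; exact hR.tail_le
      _ = _ := by ring
  have c3 : (B₃.card : ℝ) ≤ q ^ 2 * (R.l₁ * R.l₂) / 128 := by
    have := card_filter_lt_le (unitNum q) (fun p => futureWeight a₁ a₂ Q T' q p)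
      (fun p _ => futureWeight_nonneg _ _ _ _ _ _) (t := width a₁ Q * width a₂ Q / 51200)
      (by positivity) (sum_futureWeight ha hq hQ hQq)
    calc (B₃.card : ℝ) ≤ _ := this
      _ ≤ 16 * q ^ 2 * (width a₁ Q * width a₂ Q) * (R.l₁ * R.l₂ / (128 * 16 * 51200)) /
          (width a₁ Q * width a₂ Q / 51200) := by gcongr
      _ = _ := by field_simp
  have c4 : ∀ k, ((B₄ k).card : ℝ) ≤ q ^ 2 * (R.l₁ * R.l₂) / 128 / (K + 1) := by
    intro k
    have hg₁ := gridScale_pos η a₁ hQ k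
    have hg₂ := gridScale_pos η a₂ hQ k
    have := card_filter_lt_le (unitNum q)
      (fun p => crowd Q (gridScale η a₁ Q k) (gridScale η a₂ Q k) q p)
      (fun p _ => crowd_nonneg _ _ _ _ _)
      (t := (Q : ℝ) ^ (3 + η) * (gridScale η a₁ Q k * gridScale η a₂ Q k))
      (by positivity) (sum_crowd hq hg₁.le hg₂.le)
    calc ((B₄ k).card : ℝ) ≤ _ := this
      _ = 144 * q ^ 2 * (Q : ℝ) ^ (-η) := by
        rw [Real.rpow_add hQ0, Real.rpow_neg hQ0.le]
        have : (Q : ℝ) ^ (3 : ℝ) = (Q : ℝ) ^ 3 := by exact_mod_cast Real.rpow_natCast (Q : ℝ) 3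
        rw [this]
        field_simp
      _ ≤ 144 * q ^ 2 * (R.l₁ * R.l₂ / (128 * 144 * (K + 1))) := by gcongr
      _ = _ := by field_simp
  have c4' : (((Finset.range K).biUnion B₄).card : ℝ) ≤ q ^ 2 * (R.l₁ * R.l₂) / 128 := by
    calc (((Finset.range K).biUnion B₄).card : ℝ) ≤ ∑ k ∈ Finset.range K, ((B₄ k).card : ℝ) := by
          exact_mod_cast Finset.card_biUnion_le
      _ ≤ ∑ k ∈ Finset.range K, q ^ 2 * (R.l₁ * R.l₂) / 128 / (K + 1) :=
          Finset.sum_le_sum fun k _ => c4 k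
      _ = (K / (K + 1)) * (q ^ 2 * (R.l₁ * R.l₂) / 128) := by
          rw [Finset.sum_const, Finset.card_range, nsmul_eq_mul]; field_simp
      _ ≤ 1 * (q ^ 2 * (R.l₁ * R.l₂) / 128) := by
          gcongr
          rw [div_le_one (by positivity)]; linarith
      _ = _ := one_mul _
  refine ⟨C \ (B₁ ∪ B₂ ∪ B₃ ∪ (Finset.range K).biUnion B₄), ?_, ?_⟩
  · have hsd := Finset.le_card_sdiff (B₁ ∪ B₂ ∪ B₃ ∪ (Finset.range K).biUnion B₄) C
    have hu : (B₁ ∪ B₂ ∪ B₃ ∪ (Finset.range K).biUnion B₄).card ≤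
        B₁.card + B₂.card + B₃.card + ((Finset.range K).biUnion B₄).card := by
      refine (Finset.card_union_le _ _).trans (Nat.add_le_add_right ?_ _)
      refine (Finset.card_union_le _ _).trans (Nat.add_le_add_right ?_ _)
      exact Finset.card_union_le _ _
    have h3 : C.card ≤ (C \ (B₁ ∪ B₂ ∪ B₃ ∪ (Finset.range K).biUnion B₄)).card +
        (B₁.card + B₂.card + B₃.card + ((Finset.range K).biUnion B₄).card) := by omega
    have h4 : (C.card : ℝ) ≤ ((C \ (B₁ ∪ B₂ ∪ B₃ ∪ (Finset.range K).biUnion B₄)).card : ℝ) +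
        (B₁.card + B₂.card + B₃.card + ((Finset.range K).biUnion B₄).card) := by exact_mod_cast h3
    linarith
  · intro p hp
    simp only [Finset.mem_sdiff, Finset.mem_union, not_or] at hp
    obtain ⟨hpC, ⟨⟨hp1, hp2⟩, hp3⟩, hp4⟩ := hp
    have hpV := hCV hpC
    refine ⟨(hCmem p hpC).1, (hCmem p hpC).2, hpV, ?_, ?_, ?_, ?_⟩
    · intro h; exact hp1 (Finset.mem_filter.2 ⟨hpC, h⟩)
    · by_contra h; exact hp2 (Finset.mem_filter.2 ⟨hpV, not_le.1 h⟩)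
    · by_contra h; exact hp3 (Finset.mem_filter.2 ⟨hpV, not_le.1 h⟩)
    · intro k hk
      by_contra h
      exact hp4 (Finset.mem_biUnion.2
        ⟨k, Finset.mem_range.2 hk, Finset.mem_filter.2 ⟨hpV, not_le.1 h⟩⟩)

/-- The box attached to a rational point with denominator in `(Q, 2 Q]`. -/
def childBox (a₁ a₂ : ℝ) (Q : ℕ) (P : RatPt) : Box :=
  ⟨P.2.1 / P.1 + width a₁ Q / 4, width a₁ Q / 4, P.2.2 / P.1 + width a₂ Q / 4, width a₂ Q / 4⟩

lemma mem_childBox {a₁ a₂ : ℝ} {Q q : ℕ} {p : ℤ × ℤ} {y : Fin 2 → ℝ} :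
    y ∈ (childBox a₁ a₂ Q ⟨q, p⟩).toSet ↔
      ((p.1 : ℝ) / q + width a₁ Q / 4 ≤ y 0 ∧ y 0 ≤ (p.1 : ℝ) / q + width a₁ Q / 2) ∧
      ((p.2 : ℝ) / q + width a₂ Q / 4 ≤ y 1 ∧ y 1 ≤ (p.2 : ℝ) / q + width a₂ Q / 2) := by
  have h : ∀ x w : ℝ, x + w / 4 + w / 4 = x + w / 2 := fun x w => by ring
  simp only [childBox, Box.toSet, mem_ofPred_eq, h]

lemma childBox_subset {a₁ a₂ η : ℝ} {K : ℕ} {R : Box} {T : ℕ} {N : Finset RatPt} {Q T' q : ℕ}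
    {p : ℤ × ℤ} (hQ : 0 < Q) (hp : Selected a₁ a₂ η K R T N Q T' q p) (h₁ : width a₁ Q ≤ R.l₁)
    (h₂ : width a₂ Q ≤ R.l₂) : (childBox a₁ a₂ Q ⟨q, p⟩).toSet ⊆ R.toSet := by
  intro y hy
  obtain ⟨⟨h3, h4⟩, h5, h6⟩ := mem_childBox.1 hy
  have hw₁ := width_pos a₁ hQ
  have hw₂ := width_pos a₂ hQ
  have hm₁ := hp.mem₁
  have hm₂ := hp.mem₂
  refine ⟨⟨?_, ?_⟩, ?_, ?_⟩ <;> linarith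

/-- A proper fraction with prime denominator is not a fraction with smaller denominator. -/
lemma ne_of_prime {q q' : ℕ} (hq : q.Prime) (h0 : 0 < q') (hlt : q' < q) {p p' : ℤ}
    (hp : p ∈ Finset.Ioo (0 : ℤ) q) : (p' : ℝ) ≠ q' * p / q := by
  intro h
  have hq0 : (q : ℝ) ≠ 0 := by exact_mod_cast hq.ne_zero
  rw [eq_div_iff hq0] at h
  have h' : p' * q = q' * p := by exact_mod_cast h
  have hd : (q : ℤ) ∣ q' * p := ⟨p', by rw [← h', mul_comm]⟩
  obtain ⟨hp1, hp2⟩ := Finset.mem_Ioo.1 hp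
  rcases (Nat.prime_iff_prime_int.1 hq).dvd_or_dvd hd with h1 | h1
  · have := Int.le_of_dvd (by exact_mod_cast h0) h1
    omega
  · have := Int.le_of_dvd hp1 h1
    omega

lemma one_le_nearCount {q' q : ℕ} {p p' : ℤ × ℤ} {u₁ u₂ : ℝ} (h₁ : p'.1 ∈ nearNum q' q p.1 u₁)
    (h₂ : p'.2 ∈ nearNum q' q p.2 u₂) : 1 ≤ nearCount q' q p u₁ u₂ := by
  unfold nearCount
  have h3 : (1 : ℝ) ≤ (nearNum q' q p.1 u₁).card := by
    exact_mod_cast Finset.card_pos.2 ⟨_, h₁⟩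
  have h4 : (1 : ℝ) ≤ (nearNum q' q p.2 u₂).card := by
    exact_mod_cast Finset.card_pos.2 ⟨_, h₂⟩
  nlinarith

lemma width_le_rpow {a : ℝ} (ha : 0 < a) {Q q : ℕ} (hq : 0 < q) (h : q ≤ 2 * Q) :
    width a Q ≤ (q : ℝ) ^ (-a) := by
  unfold width
  apply Real.rpow_le_rpow_of_nonpos (by exact_mod_cast hq) (by exact_mod_cast h) (by linarith)

lemma rpow_le_width {a : ℝ} (ha : 0 < a) {Q q : ℕ} (hQ : 0 < Q) (h : Q ≤ q) {c : ℝ} (hc : 0 ≤ c)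
    (hca : c * 2 ^ a ≤ 1 / 4) : c * (q : ℝ) ^ (-a) ≤ width a Q / 4 := by
  have hQ0 : (0 : ℝ) < Q := by exact_mod_cast hQ
  have h1 : (q : ℝ) ^ (-a) ≤ (Q : ℝ) ^ (-a) :=
    Real.rpow_le_rpow_of_nonpos hQ0 (by exact_mod_cast h) (by linarith)
  have h2 : (Q : ℝ) ^ (-a) = 2 ^ a * width a Q := by
    unfold width
    rw [Real.mul_rpow (by norm_num) hQ0.le, ← mul_assoc, ← Real.rpow_add (by norm_num)]
    simp
  calc c * (q : ℝ) ^ (-a) ≤ c * (2 ^ a * width a Q) := by rw [← h2]; gcongr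
    _ = (c * 2 ^ a) * width a Q := by ring
    _ ≤ 1 / 4 * width a Q := by
      have := width_pos a hQ
      gcongr
    _ = _ := by ring

lemma childBox_avoid {c a₁ a₂ η : ℝ} (h₁ : 0 < a₁) (h₂ : 0 < a₂) (hc1 : c ≤ 1)
    {K : ℕ} {R : Box} {q₀ T : ℕ}
    {N : Finset RatPt} {Q T' q : ℕ} {p : ℤ × ℤ} (hR : Fertile c a₁ a₂ R q₀ T N)
    (hq : q ∈ dyadicPrimes Q) (hQ : 0 < Q)
    (hp : Selected a₁ a₂ η K R T N Q T' q p) (hw₁ : width a₁ Q ≤ R.l₁)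
    (hw₂ : width a₂ Q ≤ R.l₂) (z : RatPt) (hz : q₀ ≤ z.1) (hzq : z.1 < q) (y : Fin 2 → ℝ)
    (hy : y ∈ (childBox a₁ a₂ Q ⟨q, p⟩).toSet) : ¬ Hit c a₁ a₂ z y := by
  rintro ⟨hit₁, hit₂⟩
  obtain ⟨⟨hQq, hq2⟩, hqp⟩ := mem_dyadicPrimes.1 hq
  have hz0 : 0 < z.1 := lt_of_lt_of_le hR.q₀_pos hz
  have hz0' : (0 : ℝ) < z.1 := by exact_mod_cast hz0
  have hq0' : (0 : ℝ) < q := by exact_mod_cast hqp.pos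
  have hwz₁ : width a₁ Q ≤ (z.1 : ℝ) ^ (-a₁) := width_le_rpow h₁ hz0 (by omega)
  have hwz₂ : width a₂ Q ≤ (z.1 : ℝ) ^ (-a₂) := width_le_rpow h₂ hz0 (by omega)
  have hwp₁ := width_pos a₁ hQ
  have hwp₂ := width_pos a₂ hQ
  have hcz₁ : c * (z.1 : ℝ) ^ (-a₁) ≤ (z.1 : ℝ) ^ (-a₁) :=
    mul_le_of_le_one_left (by positivity) hc1
  have hcz₂ : c * (z.1 : ℝ) ^ (-a₂) ≤ (z.1 : ℝ) ^ (-a₂) :=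
    mul_le_of_le_one_left (by positivity) hc1
  obtain ⟨⟨h3, h4⟩, h5, h6⟩ := mem_childBox.1 hy
  have hit₁' := abs_lt.1 hit₁
  have hit₂' := abs_lt.1 hit₂
  have n₁ : |(p.1 : ℝ) / q - z.2.1 / z.1| ≤ 2 * (z.1 : ℝ) ^ (-a₁) := by
    rw [abs_le]; constructor <;> linarith
  have n₂ : |(p.2 : ℝ) / q - z.2.2 / z.1| ≤ 2 * (z.1 : ℝ) ^ (-a₂) := by
    rw [abs_le]; constructor <;> linarith
  rcases lt_or_ge z.1 T with hzT | hzT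
  · by_cases hzN : z ∈ N
    · exact hp.not_near ⟨z, hzN, n₁, n₂⟩
    · exact hR.avoid z hz hzT hzN y (childBox_subset hQ hp hw₁ hw₂ hy) ⟨hit₁, hit₂⟩
  · have hunit := Finset.mem_product.1 hp.mem_unit
    have scale : ∀ (p p' : ℤ) (e : ℝ), |(p : ℝ) / q - p' / z.1| ≤ 2 * e →
        |(p' : ℝ) - z.1 * p / q| ≤ 2 * (e * z.1) := by
      intro p p' e h
      have : (p' : ℝ) - z.1 * p / q = - (z.1 * ((p : ℝ) / q - p' / z.1)) := by field_simp; ring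
      rw [this, abs_neg, abs_mul, abs_of_pos hz0']
      calc z.1 * |(p : ℝ) / q - p' / z.1| ≤ z.1 * (2 * e) := by gcongr
        _ = _ := by ring
    have hone := one_le_nearCount (q' := z.1) (q := q) (p := p) (p' := z.2)
      (mem_nearNum.2 ⟨scale _ _ _ n₁, ne_of_prime hqp hz0 hzq hunit.1⟩)
      (mem_nearNum.2 ⟨scale _ _ _ n₂, ne_of_prime hqp hz0 hzq hunit.2⟩)
    have hle := Finset.single_le_sum (f := fun q' : ℕ => nearCount q' q p
      (2 * ((q' : ℝ) ^ (-a₁) * q')) (2 * ((q' : ℝ) ^ (-a₂) * q')))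
      (fun i _ => nearCount_nonneg _ _ _ _ _) (Finset.mem_Ico.2 ⟨hzT, hzq⟩)
    have hpast := hp.past
    unfold pastCount at hpast
    linarith

/-- The rational points of denominator in `[q, T')` threatening the box attached to `p / q`. -/
def threats (a₁ a₂ : ℝ) (Q T' q : ℕ) (p : ℤ × ℤ) : Finset RatPt :=
  (Finset.Ico q T').sigma fun q' =>
    nearNum q' q p.1 (2 * width a₁ Q * q') ×ˢ nearNum q' q p.2 (2 * width a₂ Q * q')

lemma sum_threats (a₁ a₂ : ℝ) (Q T' q : ℕ) (p : ℤ × ℤ) :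
    ∑ z ∈ threats a₁ a₂ Q T' q p, (z.1 : ℝ) ^ (-(a₁ + a₂)) = futureWeight a₁ a₂ Q T' q p := by
  unfold threats futureWeight
  rw [Finset.sum_sigma]
  apply Finset.sum_congr rfl
  intro q' _
  simp only [Finset.sum_const, Finset.card_product, nsmul_eq_mul, nearCount]
  push_cast
  ring

lemma childBox_fertile {c a₁ a₂ η : ℝ} (h₁ : 0 < a₁) (h₂ : 0 < a₂) (hc0 : 0 ≤ c)
    (hc₁ : c * 2 ^ a₁ ≤ 1 / 4) (hc₂ : c * 2 ^ a₂ ≤ 1 / 4)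
    {K : ℕ} {R : Box} {q₀ T : ℕ}
    {N : Finset RatPt} {Q T' q : ℕ} {p : ℤ × ℤ} (hR : Fertile c a₁ a₂ R q₀ T N)
    (hq : q ∈ dyadicPrimes Q) (hQ : 0 < Q)
    (hp : Selected a₁ a₂ η K R T N Q T' q p) (hw₁ : width a₁ Q ≤ R.l₁)
    (hw₂ : width a₂ Q ≤ R.l₂) (hqT : q ≤ T')
    (hT' : powTail (a₁ + a₂ - 2) T' ≤ width a₁ Q * width a₂ Q / 65536) :
    Fertile c a₁ a₂ (childBox a₁ a₂ Q ⟨q, p⟩) q T' (threats a₁ a₂ Q T' q p) := by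
  obtain ⟨⟨hQq, hq2⟩, hqp⟩ := mem_dyadicPrimes.1 hq
  have hwp₁ := width_pos a₁ hQ
  have hwp₂ := width_pos a₂ hQ
  have hm₁ := hp.mem₁
  have hm₂ := hp.mem₂
  have hb₁ := hR.b₁_pos
  have hb₂ := hR.b₂_pos
  have hl₁ := hR.lt_one₁
  have hl₂ := hR.lt_one₂
  constructor
  · simp only [childBox]; linarith
  · simp only [childBox]; linarith
  · simp only [childBox]; linarith
  · simp only [childBox]; linarith
  · simp only [childBox]; linarith
  · simp only [childBox]; linarith
  · exact hqp.pos
  · exact hqT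
  · simp only [childBox]; linarith
  · rintro ⟨q', p'⟩ hz
    have := Finset.mem_Ico.1 (Finset.mem_sigma.1 hz).1
    exact ⟨lt_of_lt_of_le hqp.pos this.1, this.2⟩
  · rw [sum_threats]
    simp only [childBox]
    linarith [hp.future]
  · rintro ⟨q', p'⟩ hz hzT hzN y hy ⟨hit₁, hit₂⟩
    apply hzN
    simp only at hz hzT hit₁ hit₂
    have hz0 : 0 < q' := lt_of_lt_of_le hqp.pos hz
    have hz0' : (0 : ℝ) < q' := by exact_mod_cast hz0
    have hq0' : (0 : ℝ) < q := by exact_mod_cast hqp.pos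
    have c₁ := rpow_le_width h₁ hQ (hQq.le.trans hz) hc0 hc₁
    have c₂ := rpow_le_width h₂ hQ (hQq.le.trans hz) hc0 hc₂
    obtain ⟨⟨h3, h4⟩, h5, h6⟩ := mem_childBox.1 hy
    have hit₁' := abs_lt.1 hit₁
    have hit₂' := abs_lt.1 hit₂
    have key : ∀ (p p' : ℤ) (w : ℝ), 0 < (p' : ℝ) / q' - p / q → (p' : ℝ) / q' - p / q ≤ w →
        p' ∈ nearNum q' q p (w * q') := by
      intro p p' w h0 h1
      have : (p' : ℝ) - q' * p / q = q' * ((p' : ℝ) / q' - p / q) := by field_simp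
      have hpos : 0 < (p' : ℝ) - q' * p / q := by rw [this]; positivity
      rw [mem_nearNum]
      refine ⟨?_, by intro h; linarith⟩
      rw [abs_of_pos hpos, this, mul_comm w]
      gcongr
    refine Finset.mem_sigma.2 ⟨Finset.mem_Ico.2 ⟨hz, hzT⟩, Finset.mem_product.2 ⟨?_, ?_⟩⟩
    · apply key <;> linarith
    · apply key <;> linarith

lemma mem_closedBall_plane {x y : Fin 2 → ℝ} {r : ℝ} (hr : 0 ≤ r) :
    y ∈ Metric.closedBall x r ↔ |y 0 - x 0| ≤ r ∧ |y 1 - x 1| ≤ r := by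
  rw [Metric.mem_closedBall, dist_pi_le_iff hr, Fin.forall_fin_two, Real.dist_eq, Real.dist_eq]

lemma width_le_inv {a : ℝ} (ha : 1 ≤ a) {Q : ℕ} (hQ : 0 < Q) : width a Q ≤ 1 / Q := by
  have hQ0 : (1 : ℝ) ≤ Q := by exact_mod_cast hQ
  unfold width
  calc (2 * Q : ℝ) ^ (-a) ≤ (2 * Q : ℝ) ^ (-1 : ℝ) :=
        Real.rpow_le_rpow_of_exponent_le (by linarith) (by linarith)
    _ = 1 / (2 * Q) := by rw [Real.rpow_neg_one, one_div]
    _ ≤ 1 / Q := by gcongr; linarith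

/-- Every scale below `1 / Q` is comparable to one of the finitely many controlled scales. -/
lemma exists_gridScale {η a₁ a₂ : ℝ} (hη : 0 < η) (ha : a₂ ≤ a₁) (ha2 : 0 < a₂) {K : ℕ}
    (hK : 2 * a₁ ≤ 1 + η * K)
    {Q : ℕ} (hQ : 2 ≤ Q) {r : ℝ} (hr : 0 < r) (hrQ : r ≤ 1 / Q) :
    ∃ k < K + 1, ∀ a, a = a₁ ∨ a = a₂ → max r (width a Q) ≤ gridScale η a Q k ∧
      gridScale η a Q k ≤ (Q : ℝ) ^ η * max r (width a Q) := by
  have hQ0 : (0 : ℝ) < Q := by positivity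
  have hQ2 : (2 : ℝ) ≤ Q := by exact_mod_cast hQ
  have hQη : 1 ≤ (Q : ℝ) ^ η := Real.one_le_rpow (by linarith) hη.le
  have hend : ∀ a, a = a₁ ∨ a = a₂ → (Q : ℝ) ^ (-1 - η * K) ≤ width a Q := by
    intro a h
    have haa : a ≤ a₁ := by rcases h with h | h <;> linarith
    have hap : 0 < a := by rcases h with h | h <;> linarith
    unfold width
    calc (Q : ℝ) ^ (-1 - η * K) ≤ (Q : ℝ) ^ (2 * -a) :=
          Real.rpow_le_rpow_of_exponent_le (by linarith) (by linarith)
      _ = ((Q : ℝ) ^ (2 : ℝ)) ^ (-a) := by rw [Real.rpow_mul hQ0.le]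
      _ ≤ (2 * Q : ℝ) ^ (-a) := by
          apply Real.rpow_le_rpow_of_nonpos (by positivity) _ (by linarith)
          rw [Real.rpow_two]; nlinarith
  by_cases hlast : r ≤ (Q : ℝ) ^ (-1 - η * (K : ℕ))
  · refine ⟨K, Nat.lt_succ_self K, fun a h => ⟨?_, ?_⟩⟩
    · exact max_le_max hlast le_rfl
    · have h1 : gridScale η a Q K = width a Q := max_eq_right (hend a h)
      rw [h1]
      calc width a Q ≤ 1 * max r (width a Q) := by rw [one_mul]; exact le_max_right _ _
        _ ≤ _ := by gcongr
  · have hex : ∃ k : ℕ, ¬ r ≤ (Q : ℝ) ^ (-1 - η * k) := ⟨K, hlast⟩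
    classical
    have hspec := Nat.find_spec hex
    have hmin := fun j => Nat.find_min hex (m := j)
    have hle := Nat.find_min' hex hlast
    set n := Nat.find hex with hn
    rcases n with _ | n
    · exfalso
      apply hspec
      simpa [Real.rpow_neg_one] using hrQ
    · refine ⟨n, by omega, fun a h => ⟨?_, ?_⟩⟩
      · exact max_le_max (not_not.1 (hmin n (Nat.lt_succ_self n))) le_rfl
      · unfold gridScale
        apply max_le
        · calc (Q : ℝ) ^ (-1 - η * n) = (Q : ℝ) ^ η * (Q : ℝ) ^ (-1 - η * (n + 1 : ℕ)) := by
                rw [← Real.rpow_add hQ0]; congr 1; push_cast; ring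
            _ ≤ (Q : ℝ) ^ η * max r (width a Q) := by
                gcongr
                exact (not_le.1 hspec).le.trans (le_max_left _ _)
        · calc width a Q ≤ 1 * max r (width a Q) := by rw [one_mul]; exact le_max_right _ _
            _ ≤ _ := by gcongr

lemma ne_of_primes {q q' : ℕ} (hq : q.Prime) (hq' : q'.Prime) (hne : q' ≠ q) {p p' : ℤ}
    (hp : p ∈ Finset.Ioo (0 : ℤ) q) : (p' : ℝ) ≠ q' * p / q := by
  intro h
  have hq0 : (q : ℝ) ≠ 0 := by exact_mod_cast hq.ne_zero
  rw [eq_div_iff hq0] at h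
  have h' : p' * q = q' * p := by exact_mod_cast h
  have hd : (q : ℤ) ∣ q' * p := ⟨p', by rw [← h', mul_comm]⟩
  obtain ⟨hp1, hp2⟩ := Finset.mem_Ioo.1 hp
  rcases (Nat.prime_iff_prime_int.1 hq).dvd_or_dvd hd with h1 | h1
  · exact hne ((Nat.prime_dvd_prime_iff_eq hq hq').1 (by exact_mod_cast h1)).symm
  · have := Int.le_of_dvd hp1 h1
    omega

/-- Few boxes of a level meet a ball of radius below `1 / Q`. -/
lemma card_childBox_meet_le {η a₁ a₂ : ℝ} (hη : 0 < η) (ha : a₂ ≤ a₁) (ha2 : 1 ≤ a₂) {K : ℕ}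
    (hK : 2 * a₁ ≤ 1 + η * K) {Q : ℕ} (hQ : 2 ≤ Q) (F : Finset RatPt)
    (hF : ∀ P ∈ F, P.1 ∈ dyadicPrimes Q ∧ P.2 ∈ unitNum P.1 ∧ ∀ k < K + 1,
      crowd Q (gridScale η a₁ Q k) (gridScale η a₂ Q k) P.1 P.2 ≤
        (Q : ℝ) ^ (3 + η) * (gridScale η a₁ Q k * gridScale η a₂ Q k))
    {x : Fin 2 → ℝ} {r : ℝ} (hr : 0 < r) (hrQ : r ≤ 1 / Q)
    (hFx : ∀ P ∈ F, ((childBox a₁ a₂ Q P).toSet ∩ Metric.closedBall x r).Nonempty) :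
    (F.card : ℝ) ≤ 169 + (Q : ℝ) ^ (3 + 3 * η) * (max r (width a₁ Q) * max r (width a₂ Q)) := by
  classical
  have hQ0 : 0 < Q := by omega
  have hQr : (0 : ℝ) < Q := by exact_mod_cast hQ0
  have hw₁ := width_pos a₁ hQ0
  have hw₂ := width_pos a₂ hQ0
  rcases F.eq_empty_or_nonempty with rfl | ⟨⟨q, p⟩, hP⟩
  · simp only [Finset.card_empty, Nat.cast_zero]; positivity
  have loc : ∀ P ∈ F, (-r - width a₁ Q / 2 ≤ (P.2.1 : ℝ) / P.1 - x 0 ∧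
      (P.2.1 : ℝ) / P.1 - x 0 ≤ r - width a₁ Q / 4) ∧
      (-r - width a₂ Q / 2 ≤ (P.2.2 : ℝ) / P.1 - x 1 ∧
      (P.2.2 : ℝ) / P.1 - x 1 ≤ r - width a₂ Q / 4) := by
    intro P hP
    obtain ⟨y, hy1, hy2⟩ := hFx P hP
    obtain ⟨⟨h3, h4⟩, h5, h6⟩ := mem_childBox.1 hy1
    obtain ⟨h7, h8⟩ := (mem_closedBall_plane hr.le).1 hy2
    rw [abs_le] at h7 h8
    refine ⟨⟨?_, ?_⟩, ?_, ?_⟩ <;> linarith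
  obtain ⟨hq, hp, hcrowd⟩ := hF _ hP
  simp only at hq hp hcrowd
  obtain ⟨⟨hQq, hq2⟩, hqp⟩ := mem_dyadicPrimes.1 hq
  obtain ⟨k, hk, hgrid⟩ := exists_gridScale hη ha (by linarith) hK hQ hr hrQ
  obtain ⟨hg₁, hg₁'⟩ := hgrid a₁ (Or.inl rfl)
  obtain ⟨hg₂, hg₂'⟩ := hgrid a₂ (Or.inr rfl)
  have hcr := hcrowd k hk
  set g₁ := gridScale η a₁ Q k
  set g₂ := gridScale η a₂ Q k
  have hg₁0 : 0 < g₁ := gridScale_pos _ _ hQ0 _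
  have hg₂0 : 0 < g₂ := gridScale_pos _ _ hQ0 _
  have near : ∀ P ∈ F, |(P.2.1 : ℝ) / P.1 - p.1 / q| ≤ 3 * max r (width a₁ Q) ∧
      |(P.2.2 : ℝ) / P.1 - p.2 / q| ≤ 3 * max r (width a₂ Q) := by
    intro P hP'
    obtain ⟨⟨h1, h2⟩, h3, h4⟩ := loc _ hP
    obtain ⟨⟨h1', h2'⟩, h3', h4'⟩ := loc _ hP'
    simp only at h1 h2 h3 h4
    have m1 := le_max_left r (width a₁ Q)
    have m2 := le_max_right r (width a₁ Q)
    have m3 := le_max_left r (width a₂ Q)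
    have m4 := le_max_right r (width a₂ Q)
    constructor <;> rw [abs_le] <;> constructor <;> linarith
  have scale : ∀ (q' : ℕ) (p p' : ℤ) (e : ℝ), 0 < q' → |(p' : ℝ) / q' - p / q| ≤ e →
      |(p' : ℝ) - q' * p / q| ≤ e * q' := by
    intro q' p p' e h0 h
    have h0' : (0 : ℝ) < q' := by exact_mod_cast h0
    have hq0 : (0 : ℝ) < q := by exact_mod_cast hqp.pos
    have : (p' : ℝ) - q' * p / q = q' * ((p' : ℝ) / q' - p / q) := by field_simp
    rw [this, abs_mul, abs_of_pos h0', mul_comm]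
    gcongr
  set same : Finset RatPt := ({q} : Finset ℕ).sigma fun _ =>
    Finset.Icc (p.1 - 6) (p.1 + 6) ×ˢ Finset.Icc (p.2 - 6) (p.2 + 6) with hsame
  set other : Finset RatPt := ((dyadicPrimes Q).erase q).sigma fun q' =>
    nearNum q' q p.1 (3 * g₁ * q') ×ˢ nearNum q' q p.2 (3 * g₂ * q') with hother
  have hsub : F ⊆ same ∪ other := by
    rintro ⟨q', p'⟩ hP'
    obtain ⟨n1, n2⟩ := near _ hP'
    obtain ⟨hq', hp', -⟩ := hF _ hP'
    simp only at n1 n2 hq' hp'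
    obtain ⟨⟨hQq', hq2'⟩, hqp'⟩ := mem_dyadicPrimes.1 hq'
    have s1 := scale q' p.1 p'.1 _ hqp'.pos n1
    have s2 := scale q' p.2 p'.2 _ hqp'.pos n2
    rw [Finset.mem_union]
    by_cases hqq : q' = q
    · left
      subst hqq
      have hq0 : (q' : ℝ) ≠ 0 := by exact_mod_cast hqp.ne_zero
      have small : ∀ (w : ℝ) (p p' : ℤ), w ≤ 1 / Q → |(p' : ℝ) - q' * p / q'| ≤ 3 * max r w * q' →
          p' ∈ Finset.Icc (p - 6) (p + 6) := by
        intro w p p' hw h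
        rw [mul_div_cancel_left₀ _ hq0] at h
        have h6 : 3 * max r w * q' ≤ 6 := by
          have hq2r : (q' : ℝ) ≤ 2 * Q := by exact_mod_cast hq2
          calc 3 * max r w * q' ≤ 3 * (1 / Q) * (2 * Q) := by
                gcongr
                exact max_le hrQ hw
            _ = 6 := by field_simp; norm_num
        have h7 := abs_le.1 (h.trans h6)
        rw [Finset.mem_Icc]
        constructor
        · have : ((p - 6 : ℤ) : ℝ) ≤ p' := by push_cast; linarith
          exact_mod_cast this
        · have : (p' : ℝ) ≤ ((p + 6 : ℤ) : ℝ) := by push_cast; linarith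
          exact_mod_cast this
      exact Finset.mem_sigma.2 ⟨Finset.mem_singleton_self _, Finset.mem_product.2
        ⟨small _ _ _ (width_le_inv (by linarith) hQ0) s1,
          small _ _ _ (width_le_inv ha2 hQ0) s2⟩⟩
    · right
      have hu := Finset.mem_product.1 hp
      refine Finset.mem_sigma.2 ⟨Finset.mem_erase.2 ⟨hqq, hq'⟩, Finset.mem_product.2
        ⟨mem_nearNum.2 ⟨s1.trans ?_, ne_of_primes hqp hqp' hqq hu.1⟩,
          mem_nearNum.2 ⟨s2.trans ?_, ne_of_primes hqp hqp' hqq hu.2⟩⟩⟩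
      · gcongr
      · gcongr
  have hsc : same.card = 169 := by
    have : ∀ n : ℤ, (n + 6 + 1 - (n - 6)).toNat = 13 := fun n => by
      ring_nf; rfl
    rw [hsame, Finset.card_sigma, Finset.sum_singleton, Finset.card_product, Int.card_Icc,
      Int.card_Icc, this, this]
  have hoc : (other.card : ℝ) = crowd Q g₁ g₂ q p := by
    rw [hother, Finset.card_sigma]
    unfold crowd nearCount
    push_cast [Finset.card_product]
    rfl
  calc (F.card : ℝ) ≤ ((same ∪ other).card : ℝ) := by exact_mod_cast Finset.card_le_card hsub
    _ ≤ same.card + other.card := by exact_mod_cast Finset.card_union_le _ _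
    _ = 169 + crowd Q g₁ g₂ q p := by rw [hoc, hsc]; norm_num
    _ ≤ 169 + (Q : ℝ) ^ (3 + η) * (g₁ * g₂) := by gcongr
    _ ≤ 169 + (Q : ℝ) ^ (3 + η) *
        (((Q : ℝ) ^ η * max r (width a₁ Q)) * ((Q : ℝ) ^ η * max r (width a₂ Q))) := by gcongr
    _ = _ := by
      have : (Q : ℝ) ^ (3 + 3 * η) = (Q : ℝ) ^ (3 + η) * (Q : ℝ) ^ η * (Q : ℝ) ^ η := by
        rw [← Real.rpow_add hQr, ← Real.rpow_add hQr]; congr 1; ring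
      rw [this]; ring

open Classical in
/-- Indicator that a box meets a set. -/
def touch (R : Box) (U : Set (Fin 2 → ℝ)) : ℝ := if (R.toSet ∩ U).Nonempty then 1 else 0

lemma touch_nonneg (R : Box) (U : Set (Fin 2 → ℝ)) : 0 ≤ touch R U := by
  unfold touch; split_ifs <;> norm_num

lemma touch_of_nonempty {R : Box} {U : Set (Fin 2 → ℝ)} (h : (R.toSet ∩ U).Nonempty) :
    touch R U = 1 := if_pos h

lemma touch_of_not {R : Box} {U : Set (Fin 2 → ℝ)} (h : ¬ (R.toSet ∩ U).Nonempty) :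
    touch R U = 0 := if_neg h

lemma touch_mono {R R' : Box} {U : Set (Fin 2 → ℝ)} (h : R.toSet ⊆ R'.toSet) :
    touch R U ≤ touch R' U := by
  by_cases h1 : (R.toSet ∩ U).Nonempty
  · rw [touch_of_nonempty h1, touch_of_nonempty (h1.mono (inter_subset_inter_left _ h))]
  · rw [touch_of_not h1]; exact touch_nonneg _ _

/-- A finite collection of boxes, indexed by rational points, carrying masses. -/
structure Level where
  S : Finset RatPt
  m : RatPt → ℝ
  box : RatPt → Box

/-- The total mass of the boxes meeting a set. -/
def Level.mass (L : Level) (U : Set (Fin 2 → ℝ)) : ℝ := ∑ P ∈ L.S, L.m P * touch (L.box P) U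

/-- The boxes are fertile, lie in `B`, and avoid the rational points of denominators treated so
far. -/
structure Level.Good (c a₁ a₂ : ℝ) (q₀ : ℕ) (B : Set (Fin 2 → ℝ)) (L : Level) : Prop where
  nonneg : ∀ P ∈ L.S, 0 ≤ L.m P
  sum_one : ∑ P ∈ L.S, L.m P = 1
  fertile : ∀ P ∈ L.S, ∃ T N, Fertile c a₁ a₂ (L.box P) P.1 T N
  subset : ∀ P ∈ L.S, (L.box P).toSet ⊆ B
  avoid : ∀ P ∈ L.S, ∀ z : RatPt, q₀ ≤ z.1 → z.1 < P.1 → ∀ y ∈ (L.box P).toSet, ¬ Hit c a₁ a₂ z y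

/-- The level consists of boxes attached to denominators in `(Q, 2 Q]`, none of them too heavy and
not too many of them in a ball. -/
structure Level.AtScale (a₁ a₂ η : ℝ) (Q : ℕ) (L : Level) : Prop where
  mem : ∀ P ∈ L.S, P.1 ∈ dyadicPrimes Q
  box_eq : ∀ P ∈ L.S, L.box P = childBox a₁ a₂ Q P
  m_le : ∀ P ∈ L.S, L.m P ≤ (Q : ℝ) ^ (-3 + η)
  card_le : ∀ F ⊆ L.S, ∀ (x : Fin 2 → ℝ) (r : ℝ), 0 < r → r ≤ 1 / Q →
    (∀ P ∈ F, ((L.box P).toSet ∩ Metric.closedBall x r).Nonempty) →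
    (F.card : ℝ) ≤ 169 + (Q : ℝ) ^ (3 + 3 * η) * (max r (width a₁ Q) * max r (width a₂ Q))

/-- The proportion of a box lying in a square of side `r`, up to constants. -/
def Box.portion (R : Box) (r : ℝ) : ℝ := min (r / R.l₁) 1 * min (r / R.l₂) 1

/-- `L'` refines `L` by boxes that are well spread at scales above `1 / Q`. -/
structure Level.Refines (Q : ℕ) (L L' : Level) : Prop where
  subset : ∀ X ∈ L'.S, ∃ P ∈ L.S, (L'.box X).toSet ⊆ (L.box P).toSet
  mass_le : ∀ U, L'.mass U ≤ L.mass U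
  mass_ball_le : ∀ (x : Fin 2 → ℝ) (r : ℝ), 1 / (Q : ℝ) ≤ r → L'.mass (Metric.closedBall x r) ≤
    512 * ∑ P ∈ L.S, L.m P * (touch (L.box P) (Metric.closedBall x r) * (L.box P).portion r)

lemma coord_card_le {q : ℕ} (hq : 0 < q) {b l r x : ℝ} (hl0 : 0 < l) (hl : 1 ≤ q * l)
    (hr : 1 ≤ q * r) (F : Finset ℤ)
    (h₁ : ∀ p ∈ F, b ≤ (p : ℝ) / q ∧ (p : ℝ) / q ≤ b + l / 2)
    (h₂ : ∀ p ∈ F, x - 3 / 2 * r ≤ (p : ℝ) / q ∧ (p : ℝ) / q ≤ x + 3 / 2 * r) :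
    (F.card : ℝ) ≤ 4 * (q * l) * min (r / l) 1 := by
  have hq0 : (0 : ℝ) < q := by exact_mod_cast hq
  have hr0 : 0 ≤ r := by
    by_contra h
    have := mul_neg_of_pos_of_neg hq0 (not_le.1 h)
    linarith
  have e1 := card_num_le hq (b := b) (l := l / 2) (by linarith) F h₁
  have e2 := card_num_le hq (b := x - 3 / 2 * r) (l := 3 * r) (by linarith) F
    (fun p hp => ⟨(h₂ p hp).1, by linarith [(h₂ p hp).2]⟩)
  rw [mul_min_of_nonneg _ _ (by positivity)]
  apply le_min
  · have : 4 * (q * l) * (r / l) = 4 * (q * r) := by field_simp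
    rw [this]; linarith
  · linarith

lemma sum_touch_le {a₁ a₂ η : ℝ} (h₁ : 1 ≤ a₁) (h₂ : 1 ≤ a₂) {K : ℕ} {R : Box} {T : ℕ}
    {N : Finset RatPt} {Q T' q : ℕ} (hQ : 0 < Q) (hQq : Q < q) (G : Finset (ℤ × ℤ))
    (hG : ∀ p ∈ G, Selected a₁ a₂ η K R T N Q T' q p) (hl₁ : 1 / (Q : ℝ) ≤ R.l₁)
    (hl₂ : 1 / (Q : ℝ) ≤ R.l₂) (x : Fin 2 → ℝ) {r : ℝ} (hr : 1 / (Q : ℝ) ≤ r) :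
    ∑ p ∈ G, touch (childBox a₁ a₂ Q ⟨q, p⟩) (Metric.closedBall x r) ≤
      512 * (q ^ 2 * (R.l₁ * R.l₂) / 32) * R.portion r := by
  classical
  have hq : 0 < q := by omega
  have hq0 : (0 : ℝ) < q := by exact_mod_cast hq
  have hQ0 : (0 : ℝ) < Q := by exact_mod_cast hQ
  have hQqr : (Q : ℝ) ≤ q := by exact_mod_cast hQq.le
  have hi : 0 < 1 / (Q : ℝ) := by positivity
  have hqv : ∀ v, 1 / (Q : ℝ) ≤ v → 1 ≤ q * v := by
    intro v hv
    calc (1 : ℝ) = Q * (1 / Q) := by field_simp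
      _ ≤ q * v := by gcongr
  have hw₁ := width_pos a₁ hQ
  have hw₂ := width_pos a₂ hQ
  have hw₁' := width_le_inv h₁ hQ
  have hw₂' := width_le_inv h₂ hQ
  set G' := G.filter
    (fun p => ((childBox a₁ a₂ Q ⟨q, p⟩).toSet ∩ Metric.closedBall x r).Nonempty) with hG'
  have e1 : ∑ p ∈ G, touch (childBox a₁ a₂ Q ⟨q, p⟩) (Metric.closedBall x r) = G'.card := by
    unfold touch
    rw [hG', Finset.card_filter]
    push_cast
    rfl
  have hloc : ∀ p ∈ G', (x 0 - 3 / 2 * r ≤ (p.1 : ℝ) / q ∧ (p.1 : ℝ) / q ≤ x 0 + 3 / 2 * r) ∧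
      (x 1 - 3 / 2 * r ≤ (p.2 : ℝ) / q ∧ (p.2 : ℝ) / q ≤ x 1 + 3 / 2 * r) := by
    intro p hp
    obtain ⟨y, hy1, hy2⟩ := (Finset.mem_filter.1 hp).2
    obtain ⟨⟨h3, h4⟩, h5, h6⟩ := mem_childBox.1 hy1
    obtain ⟨h7, h8⟩ := (mem_closedBall_plane (by linarith)).1 hy2
    rw [abs_le] at h7 h8
    refine ⟨⟨?_, ?_⟩, ?_, ?_⟩ <;> linarith
  have hsub : G' ⊆ G'.image Prod.fst ×ˢ G'.image Prod.snd := Finset.subset_product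
  have c1 := coord_card_le hq (b := R.b₁) (x := x 0) (by linarith) (hqv _ hl₁) (hqv _ hr)
    (G'.image Prod.fst)
    (fun v hv => by
      obtain ⟨p, hp, rfl⟩ := Finset.mem_image.1 hv
      exact (hG p (Finset.mem_filter.1 hp).1).mem₁)
    (fun v hv => by
      obtain ⟨p, hp, rfl⟩ := Finset.mem_image.1 hv
      exact (hloc p hp).1)
  have c2 := coord_card_le hq (b := R.b₂) (x := x 1) (by linarith) (hqv _ hl₂) (hqv _ hr)
    (G'.image Prod.snd)
    (fun v hv => by
      obtain ⟨p, hp, rfl⟩ := Finset.mem_image.1 hv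
      exact (hG p (Finset.mem_filter.1 hp).1).mem₂)
    (fun v hv => by
      obtain ⟨p, hp, rfl⟩ := Finset.mem_image.1 hv
      exact (hloc p hp).2)
  rw [e1]
  calc (G'.card : ℝ) ≤ ((G'.image Prod.fst).card : ℝ) * ((G'.image Prod.snd).card : ℝ) := by
        have := Finset.card_le_card hsub
        rw [Finset.card_product] at this
        exact_mod_cast this
    _ ≤ (4 * (q * R.l₁) * min (r / R.l₁) 1) * (4 * (q * R.l₂) * min (r / R.l₂) 1) :=
        mul_le_mul c1 c2 (by positivity) (le_trans (by positivity) c1)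
    _ = _ := by unfold Box.portion; ring

/-- Redistributing masses from parents equally to their children. -/
lemma sum_spread {α β : Type*} [DecidableEq β] (S : Finset α) (ch : α → Finset β) (m : α → ℝ)
    (g : β → ℝ) :
    ∑ X ∈ S.biUnion ch, (∑ P ∈ S, if X ∈ ch P then m P / (ch P).card else 0) * g X =
      ∑ P ∈ S, m P / (ch P).card * ∑ X ∈ ch P, g X := by
  simp_rw [Finset.sum_mul]
  rw [Finset.sum_comm]
  apply Finset.sum_congr rfl
  intro P hP
  simp_rw [ite_mul, zero_mul]
  rw [Finset.sum_ite_mem, Finset.inter_eq_right.2 (Finset.subset_biUnion_of_mem ch hP),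
    Finset.mul_sum]

/-- Every level admits refinements at arbitrarily large scales. -/
lemma Level.Good.exists_next {c a₁ a₂ η : ℝ} (ha : 3 < a₁ + a₂) (h₁ : a₂ ≤ a₁) (h₂ : 1 ≤ a₂)
    (hη : 0 < η) (hη1 : η < 1) (hc0 : 0 ≤ c) (hc₁ : c * 2 ^ a₁ ≤ 1 / 4)
    (hc₂ : c * 2 ^ a₂ ≤ 1 / 4) (hc1 : c ≤ 1) {q₀ : ℕ} {B : Set (Fin 2 → ℝ)} {L : Level}
    (hL : L.Good c a₁ a₂ q₀ B) :
    ∃ᶠ Q : ℕ in Filter.atTop, ∃ L' : Level, L'.Good c a₁ a₂ q₀ B ∧ L'.AtScale a₁ a₂ η Q ∧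
      L.Refines Q L' := by
  classical
  obtain ⟨K, hK⟩ : ∃ K : ℕ, 2 * a₁ ≤ 1 + η * K := by
    obtain ⟨K, hK⟩ := exists_nat_ge (2 * a₁ / η)
    refine ⟨K, ?_⟩
    rw [div_le_iff₀ hη] at hK
    linarith
  choose! T N hf using hL.fertile
  have hcast : Filter.Tendsto (fun Q : ℕ => (Q : ℝ)) Filter.atTop Filter.atTop :=
    tendsto_natCast_atTop_atTop
  have hinv : Filter.Tendsto (fun Q : ℕ => 1 / (Q : ℝ)) Filter.atTop (nhds 0) :=
    tendsto_one_div_atTop_nhds_zero_nat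
  have hrp : Filter.Tendsto (fun Q : ℕ => (Q : ℝ) ^ (η / 2)) Filter.atTop Filter.atTop :=
    (tendsto_rpow_atTop (by linarith)).comp hcast
  have hev : ∀ᶠ Q : ℕ in Filter.atTop, ∀ P ∈ L.S,
      (∀ T' q : ℕ, q ∈ dyadicPrimes Q → ∃ G : Finset (ℤ × ℤ),
        q ^ 2 * ((L.box P).l₁ * (L.box P).l₂) / 32 ≤ (G.card : ℝ) ∧
        ∀ p ∈ G, Selected a₁ a₂ η (K + 1) (L.box P) (T P) (N P) Q T' q p) ∧
      1 / (Q : ℝ) ≤ (L.box P).l₁ ∧ 1 / (Q : ℝ) ≤ (L.box P).l₂ ∧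
      32 / ((L.box P).l₁ * (L.box P).l₂) ≤ (Q : ℝ) ^ (η / 2) := by
    rw [Filter.eventually_all_finset]
    intro P hP
    have hl₁ := (hf P hP).l₁_pos
    have hl₂ := (hf P hP).l₂_pos
    filter_upwards [exists_selected ha (by linarith) (by linarith) hη (K + 1) (hf P hP),
      hinv.eventually (gt_mem_nhds hl₁), hinv.eventually (gt_mem_nhds hl₂),
      hrp.eventually_ge_atTop (32 / ((L.box P).l₁ * (L.box P).l₂))] with Q k1 k2 k3 k4
    exact ⟨k1, k2.le, k3.le, k4⟩
  have hfr := (frequently_dyadicPrimes (η := η / 2) (by linarith) (by linarith)).and_eventually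
    (hev.and (Filter.eventually_ge_atTop 2))
  refine hfr.mono ?_
  rintro Q ⟨hprime, hev, hQ2⟩
  have hQ : 0 < Q := by omega
  have hQ0 : (0 : ℝ) < Q := by exact_mod_cast hQ
  have hwp₁ := width_pos a₁ hQ
  have hwp₂ := width_pos a₂ hQ
  have hwi₁ := width_le_inv (a := a₁) (by linarith) hQ
  have hwi₂ := width_le_inv h₂ hQ
  obtain ⟨T', hT'Q, hT'⟩ : ∃ T' : ℕ, 2 * Q ≤ T' ∧
      powTail (a₁ + a₂ - 2) T' ≤ width a₁ Q * width a₂ Q / 65536 := by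
    have h := (powTail_tendsto (a₁ + a₂ - 2)).eventually
      (gt_mem_nhds (show 0 < width a₁ Q * width a₂ Q / 65536 by positivity))
    obtain ⟨T', h1, h2⟩ := (h.and (Filter.eventually_ge_atTop (2 * Q))).exists
    exact ⟨T', h2, h1.le⟩
  have hG : ∀ (P : RatPt) (q : ℕ), P ∈ L.S → q ∈ dyadicPrimes Q → ∃ G : Finset (ℤ × ℤ),
      q ^ 2 * ((L.box P).l₁ * (L.box P).l₂) / 32 ≤ (G.card : ℝ) ∧
        ∀ p ∈ G, Selected a₁ a₂ η (K + 1) (L.box P) (T P) (N P) Q T' q p :=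
    fun P q hP hq => (hev P hP).1 T' q hq
  choose! G hGcard hGsel using hG
  set ch : RatPt → Finset RatPt := fun P => (dyadicPrimes Q).sigma (G P) with hch
  have hchmem : ∀ P ∈ L.S, ∀ X ∈ ch P, X.1 ∈ dyadicPrimes Q ∧
      Selected a₁ a₂ η (K + 1) (L.box P) (T P) (N P) Q T' X.1 X.2 := by
    intro P hP X hX
    obtain ⟨h3, h4⟩ := Finset.mem_sigma.1 hX
    exact ⟨h3, hGsel P X.1 hP h3 _ h4⟩
  have hw : ∀ P ∈ L.S, width a₁ Q ≤ (L.box P).l₁ ∧ width a₂ Q ≤ (L.box P).l₂ :=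
    fun P hP => ⟨hwi₁.trans (hev P hP).2.1, hwi₂.trans (hev P hP).2.2.1⟩
  have hchsub : ∀ P ∈ L.S, ∀ X ∈ ch P,
      (childBox a₁ a₂ Q X).toSet ⊆ (L.box P).toSet := fun P hP X hX =>
    childBox_subset hQ (hchmem P hP X hX).2 (hw P hP).1 (hw P hP).2
  have hchcard : ∀ P ∈ L.S,
      ∑ q ∈ dyadicPrimes Q, (q ^ 2 * ((L.box P).l₁ * (L.box P).l₂) / 32 : ℝ) ≤
        ((ch P).card : ℝ) := by
    intro P hP
    rw [hch, Finset.card_sigma]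
    push_cast
    exact Finset.sum_le_sum fun q hq => hGcard P q hP hq
  have hchbig : ∀ P ∈ L.S, (Q : ℝ) ^ (3 - η) ≤ ((ch P).card : ℝ) := by
    intro P hP
    have hl₁ := (hf P hP).l₁_pos
    have hl₂ := (hf P hP).l₂_pos
    have hll : 0 < (L.box P).l₁ * (L.box P).l₂ := mul_pos hl₁ hl₂
    have h5 := (hev P hP).2.2.2
    rw [div_le_iff₀ hll] at h5
    have h6 : (1 : ℝ) ≤ (Q : ℝ) ^ (η / 2) * ((L.box P).l₁ * (L.box P).l₂) / 32 := by linarith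
    refine le_trans ?_ (hchcard P hP)
    have hpow : (Q : ℝ) ^ (1 - η / 2) * (Q : ℝ) ^ 2 = (Q : ℝ) ^ (3 - η) * (Q : ℝ) ^ (η / 2) := by
      rw [← Real.rpow_natCast, ← Real.rpow_add hQ0, ← Real.rpow_add hQ0]
      congr 1; push_cast; ring
    calc (Q : ℝ) ^ (3 - η) = (Q : ℝ) ^ (3 - η) * 1 := (mul_one _).symm
      _ ≤ (Q : ℝ) ^ (3 - η) *
          ((Q : ℝ) ^ (η / 2) * ((L.box P).l₁ * (L.box P).l₂) / 32) := by gcongr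
      _ = (Q : ℝ) ^ (1 - η / 2) * ((Q : ℝ) ^ 2 * ((L.box P).l₁ * (L.box P).l₂) / 32) := by
          linear_combination (-((L.box P).l₁ * (L.box P).l₂) / 32) * hpow
      _ ≤ (dyadicPrimes Q).card * ((Q : ℝ) ^ 2 * ((L.box P).l₁ * (L.box P).l₂) / 32) := by
          gcongr
      _ = ∑ q ∈ dyadicPrimes Q, ((Q : ℝ) ^ 2 * ((L.box P).l₁ * (L.box P).l₂) / 32) := by
          rw [Finset.sum_const, nsmul_eq_mul]
      _ ≤ _ := by
          apply Finset.sum_le_sum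
          intro q hq
          have : (Q : ℝ) ≤ q := by exact_mod_cast (mem_dyadicPrimes.1 hq).1.1.le
          gcongr
  have hchpos : ∀ P ∈ L.S, (0 : ℝ) < (ch P).card := fun P hP =>
    lt_of_lt_of_le (by positivity) (hchbig P hP)
  have hmem' : ∀ X ∈ L.S.biUnion ch, ∃ P ∈ L.S, X ∈ ch P := fun X hX => Finset.mem_biUnion.1 hX
  refine ⟨⟨L.S.biUnion ch, fun X => ∑ P ∈ L.S, if X ∈ ch P then L.m P / (ch P).card else 0,
    childBox a₁ a₂ Q⟩, ⟨?_, ?_, ?_, ?_, ?_⟩, ⟨?_, ?_, ?_, ?_⟩, ?_, ?_, ?_⟩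
  · intro X _
    apply Finset.sum_nonneg
    intro P hP
    split_ifs
    · exact div_nonneg (hL.nonneg P hP) (by positivity)
    · exact le_rfl
  · have h := sum_spread L.S ch L.m (fun _ => 1)
    simp only [mul_one, Finset.sum_const, nsmul_eq_mul] at h
    simp only
    rw [h, ← hL.sum_one]
    exact Finset.sum_congr rfl fun P hP => div_mul_cancel₀ _ (hchpos P hP).ne'
  · intro X hX
    obtain ⟨P, hP, hXP⟩ := hmem' X hX
    obtain ⟨h3, h4⟩ := hchmem P hP X hXP
    exact ⟨T', _, childBox_fertile (by linarith) (by linarith) hc0 hc₁ hc₂ (hf P hP) h3 hQ h4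
      (hw P hP).1 (hw P hP).2 ((mem_dyadicPrimes.1 h3).1.2.trans hT'Q) hT'⟩
  · intro X hX
    obtain ⟨P, hP, hXP⟩ := hmem' X hX
    exact (hchsub P hP X hXP).trans (hL.subset P hP)
  · intro X hX z hz hzX y hy
    obtain ⟨P, hP, hXP⟩ := hmem' X hX
    obtain ⟨h3, h4⟩ := hchmem P hP X hXP
    rcases lt_or_ge z.1 P.1 with h | h
    · exact hL.avoid P hP z hz h y (hchsub P hP X hXP hy)
    · exact childBox_avoid (by linarith) (by linarith) hc1 (hf P hP) h3 hQ h4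
        (hw P hP).1 (hw P hP).2 z h hzX y hy
  · intro X hX
    obtain ⟨P, hP, hXP⟩ := hmem' X hX
    exact (hchmem P hP X hXP).1
  · intro X _
    rfl
  · intro X _
    simp only
    calc _ ≤ ∑ P ∈ L.S, L.m P * (Q : ℝ) ^ (-3 + η) := by
          apply Finset.sum_le_sum
          intro P hP
          have hmP := hL.nonneg P hP
          split_ifs
          · rw [div_eq_mul_inv]
            gcongr
            have : (Q : ℝ) ^ (-3 + η) = ((Q : ℝ) ^ (3 - η))⁻¹ := by
              rw [← Real.rpow_neg hQ0.le]; congr 1; ring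
            rw [this]
            gcongr
            exact hchbig P hP
          · positivity
      _ = _ := by rw [← Finset.sum_mul, hL.sum_one, one_mul]
  · intro F hF x r hr hrQ hFx
    refine card_childBox_meet_le hη h₁ h₂ hK hQ2 F ?_ hr hrQ hFx
    intro X hX
    obtain ⟨P, hP, hXP⟩ := hmem' X (hF hX)
    obtain ⟨h3, h4⟩ := hchmem P hP X hXP
    exact ⟨h3, h4.mem_unit, h4.crowd_le⟩
  · intro X hX
    obtain ⟨P, hP, hXP⟩ := hmem' X hX
    exact ⟨P, hP, hchsub P hP X hXP⟩
  · intro U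
    unfold Level.mass
    simp only
    rw [sum_spread]
    apply Finset.sum_le_sum
    intro P hP
    have hmP := hL.nonneg P hP
    calc L.m P / (ch P).card * ∑ X ∈ ch P, touch (childBox a₁ a₂ Q X) U
        ≤ L.m P / (ch P).card * ∑ X ∈ ch P, touch (L.box P) U := by
          gcongr with X hX
          exact touch_mono (hchsub P hP X hX)
      _ = _ := by
          have := (hchpos P hP).ne'
          rw [Finset.sum_const, nsmul_eq_mul]; field_simp
  · intro x r hr
    unfold Level.mass
    simp only
    rw [sum_spread, Finset.mul_sum]
    apply Finset.sum_le_sum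
    intro P hP
    have hmP := hL.nonneg P hP
    by_cases ht : ((L.box P).toSet ∩ Metric.closedBall x r).Nonempty
    · rw [touch_of_nonempty ht]
      have hr0 : 0 < r := lt_of_lt_of_le (by positivity) hr
      have hl₁ := (hf P hP).l₁_pos
      have hl₂ := (hf P hP).l₂_pos
      have hpor : 0 ≤ (L.box P).portion r := by unfold Box.portion; positivity
      calc _ = L.m P / (ch P).card * ∑ q ∈ dyadicPrimes Q, ∑ p ∈ G P q,
            touch (childBox a₁ a₂ Q ⟨q, p⟩) (Metric.closedBall x r) := by
            rw [hch, Finset.sum_sigma]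
        _ ≤ L.m P / (ch P).card * ∑ q ∈ dyadicPrimes Q,
            512 * (q ^ 2 * ((L.box P).l₁ * (L.box P).l₂) / 32) * (L.box P).portion r := by
            gcongr with q hq
            exact sum_touch_le (by linarith) h₂ hQ (mem_dyadicPrimes.1 hq).1.1 _
              (hGsel P q hP hq) (hev P hP).2.1 (hev P hP).2.2.1 x hr
        _ = L.m P / (ch P).card * (512 * (∑ q ∈ dyadicPrimes Q,
            (q ^ 2 * ((L.box P).l₁ * (L.box P).l₂) / 32)) * (L.box P).portion r) := by
            rw [← Finset.sum_mul, ← Finset.mul_sum]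
        _ ≤ L.m P / (ch P).card * (512 * (ch P).card * (L.box P).portion r) := by
            gcongr
            exact hchcard P hP
        _ = _ := by
            have := (hchpos P hP).ne'
            field_simp
    · have : ∀ X ∈ ch P, touch (childBox a₁ a₂ Q X) (Metric.closedBall x r) = 0 := by
        intro X hX
        exact touch_of_not fun h => ht (h.mono (inter_subset_inter_left _ (hchsub P hP X hX)))
      rw [Finset.sum_eq_zero this, touch_of_not ht]
      simp

lemma min_one_le_rpow {t α : ℝ} (ht : 0 < t) (h0 : 0 ≤ α) (h1 : α ≤ 1) : min t 1 ≤ t ^ α := by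
  rcases le_total t 1 with h | h
  · rw [min_eq_left h]
    calc t = t ^ (1 : ℝ) := (Real.rpow_one t).symm
      _ ≤ t ^ α := Real.rpow_le_rpow_of_exponent_ge ht h h1
  · rw [min_eq_right h]
    exact Real.one_le_rpow h h0

lemma min_div_width_le {a α r : ℝ} {Q : ℕ} (hQ : 0 < Q) (hr : 0 < r) (h0 : 0 ≤ α) (h1 : α ≤ 1) :
    min (r / width a Q) 1 ≤ r ^ α * (2 * Q : ℝ) ^ (a * α) := by
  have hw := width_pos a hQ
  refine (min_one_le_rpow (div_pos hr hw) h0 h1).trans (le_of_eq ?_)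
  have : r / width a Q = r * (2 * Q : ℝ) ^ a := by
    unfold width
    rw [Real.rpow_neg (by positivity), div_inv_eq_mul]
  rw [this, Real.mul_rpow hr.le (by positivity), ← Real.rpow_mul (by positivity)]

lemma max_mul_min_div {r w : ℝ} (hw : 0 < w) : max r w * min (r / w) 1 = r := by
  rcases le_total r w with h | h
  · rw [max_eq_right h, min_eq_left ((div_le_one hw).2 h)]; field_simp
  · rw [max_eq_left h, min_eq_right ((one_le_div hw).2 h), mul_one]

lemma min_div_quarter_le {r w : ℝ} (hr : 0 < r) (hw : 0 < w) :
    min (r / (w / 4)) 1 ≤ 4 * min (r / w) 1 := by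
  rw [mul_min_of_nonneg _ _ (by norm_num : (0 : ℝ) ≤ 4)]
  refine min_le_min (le_of_eq ?_) (by norm_num)
  field_simp

lemma portion_childBox_le {a₁ a₂ : ℝ} {Q : ℕ} (hQ : 0 < Q) (P : RatPt) {r : ℝ} (hr : 0 < r) :
    (childBox a₁ a₂ Q P).portion r ≤
      16 * (min (r / width a₁ Q) 1 * min (r / width a₂ Q) 1) := by
  have hw₁ := width_pos a₁ hQ
  have hw₂ := width_pos a₂ hQ
  unfold Box.portion childBox
  calc _ ≤ (4 * min (r / width a₁ Q) 1) * (4 * min (r / width a₂ Q) 1) := by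
        gcongr
        · exact min_div_quarter_le hr hw₁
        · exact min_div_quarter_le hr hw₂
    _ = _ := by ring

/-- The mass of a ball at scales between `1 / Q'` and `1 / Q`. -/
lemma eventually_mass_ball_le {c a₁ a₂ η s α β : ℝ} (hα0 : 0 ≤ α) (hα1 : α ≤ 1)
    (hβ0 : 0 ≤ β) (hβ1 : β ≤ 1) (hs : α + β = s) (hA : a₁ * α + a₂ * β + η < 3)
    (hη : 4 * η + s < 2) (q₀ : ℕ) (B : Set (Fin 2 → ℝ)) :
    ∀ᶠ Q : ℕ in Filter.atTop, ∀ (L L' : Level) (Q' : ℕ), L.Good c a₁ a₂ q₀ B →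
      L.AtScale a₁ a₂ η Q → L.Refines Q' L' → ∀ (x : Fin 2 → ℝ) (r : ℝ), 0 < r →
      1 / (Q' : ℝ) ≤ r → r ≤ 1 / (Q : ℝ) → L'.mass (Metric.closedBall x r) ≤ r ^ s := by
  have hcast : Filter.Tendsto (fun Q : ℕ => (Q : ℝ)) Filter.atTop Filter.atTop :=
    tendsto_natCast_atTop_atTop
  set A := a₁ * α + a₂ * β with hAdef
  have e1 : ∀ᶠ Q : ℕ in Filter.atTop,
      (Q : ℝ) ^ (-(3 - A - η)) < 1 / (2 * (512 * 16 * 169 * 2 ^ A)) :=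
    ((tendsto_rpow_neg_atTop (by linarith)).comp hcast).eventually (gt_mem_nhds (by positivity))
  have e2 : ∀ᶠ Q : ℕ in Filter.atTop,
      (Q : ℝ) ^ (-(2 - s - 4 * η)) < 1 / (2 * (512 * 16)) :=
    ((tendsto_rpow_neg_atTop (by linarith)).comp hcast).eventually (gt_mem_nhds (by positivity))
  filter_upwards [e1, e2, Filter.eventually_gt_atTop 0] with Q e1 e2 hQ
  intro L L' Q' hL hLQ hLL x r hr hrQ' hrQ
  classical
  have hQ0 : (0 : ℝ) < Q := by exact_mod_cast hQ
  have hw₁ := width_pos a₁ hQ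
  have hw₂ := width_pos a₂ hQ
  set μ₁ := min (r / width a₁ Q) 1 with hμ₁
  set μ₂ := min (r / width a₂ Q) 1 with hμ₂
  have hμ₁0 : 0 < μ₁ := lt_min (by positivity) one_pos
  have hμ₂0 : 0 < μ₂ := lt_min (by positivity) one_pos
  have hrs : 0 < r ^ s := by positivity
  set F := L.S.filter (fun P => ((L.box P).toSet ∩ Metric.closedBall x r).Nonempty) with hF
  have hFc := hLQ.card_le F (Finset.filter_subset _ _) x r hr hrQ
    (fun P hP => (Finset.mem_filter.1 hP).2)
  have hFs : ∑ P ∈ L.S, touch (L.box P) (Metric.closedBall x r) = F.card := by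
    unfold touch
    rw [hF, Finset.card_filter]
    push_cast
    rfl
  have hμ : μ₁ * μ₂ ≤ r ^ s * (2 ^ A * (Q : ℝ) ^ A) := by
    calc μ₁ * μ₂ ≤ (r ^ α * (2 * Q : ℝ) ^ (a₁ * α)) * (r ^ β * (2 * Q : ℝ) ^ (a₂ * β)) := by
          gcongr
          · exact min_div_width_le hQ hr hα0 hα1
          · exact min_div_width_le hQ hr hβ0 hβ1
      _ = (r ^ α * r ^ β) * ((2 * Q : ℝ) ^ (a₁ * α) * (2 * Q : ℝ) ^ (a₂ * β)) := by ring
      _ = r ^ s * (2 * Q : ℝ) ^ A := by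
          rw [← Real.rpow_add hr, ← Real.rpow_add (by positivity), hs]
      _ = _ := by rw [Real.mul_rpow (by norm_num) hQ0.le]
  have hr2 : r ^ 2 ≤ r ^ s * (Q : ℝ) ^ (-(2 - s)) := by
    have h2s : 0 ≤ 2 - s := by
      by_contra h
      linarith
    have : r ^ 2 = r ^ s * r ^ (2 - s) := by
      rw [← Real.rpow_add hr, ← Real.rpow_two]; congr 1; ring
    rw [this, Real.rpow_neg hQ0.le, ← Real.inv_rpow hQ0.le]
    gcongr
    rwa [one_div] at hrQ
  have hmax : μ₁ * μ₂ * (max r (width a₁ Q) * max r (width a₂ Q)) = r ^ 2 := by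
    have h3 := max_mul_min_div (r := r) hw₁
    have h4 := max_mul_min_div (r := r) hw₂
    calc _ = (max r (width a₁ Q) * μ₁) * (max r (width a₂ Q) * μ₂) := by ring
      _ = r * r := by rw [h3, h4]
      _ = _ := by ring
  have hp1 : (Q : ℝ) ^ (-3 + η) * (Q : ℝ) ^ A = (Q : ℝ) ^ (-(3 - A - η)) := by
    rw [← Real.rpow_add hQ0]; congr 1; ring
  have hp2 : (Q : ℝ) ^ (-3 + η) * (Q : ℝ) ^ (3 + 3 * η) * (Q : ℝ) ^ (-(2 - s)) =
      (Q : ℝ) ^ (-(2 - s - 4 * η)) := by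
    rw [← Real.rpow_add hQ0, ← Real.rpow_add hQ0]; congr 1; ring
  calc L'.mass (Metric.closedBall x r)
      ≤ 512 * ∑ P ∈ L.S, L.m P *
        (touch (L.box P) (Metric.closedBall x r) * (L.box P).portion r) :=
        hLL.mass_ball_le x r hrQ'
    _ ≤ 512 * ∑ P ∈ L.S, (Q : ℝ) ^ (-3 + η) *
        (touch (L.box P) (Metric.closedBall x r) * (16 * (μ₁ * μ₂))) := by
        gcongr with P hP
        · unfold touch; split_ifs <;> norm_num
          rw [hLQ.box_eq P hP]; unfold Box.portion childBox; positivity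
        · exact hLQ.m_le P hP
        · exact touch_nonneg _ _
        · rw [hLQ.box_eq P hP]; exact portion_childBox_le hQ P hr
    _ = 512 * 16 * (Q : ℝ) ^ (-3 + η) * (μ₁ * μ₂) * F.card := by
        rw [← Finset.mul_sum, ← Finset.sum_mul, hFs]; ring
    _ ≤ 512 * 16 * (Q : ℝ) ^ (-3 + η) * (μ₁ * μ₂) *
        (169 + (Q : ℝ) ^ (3 + 3 * η) * (max r (width a₁ Q) * max r (width a₂ Q))) := by
        gcongr
    _ = 512 * 16 * 169 * (Q : ℝ) ^ (-3 + η) * (μ₁ * μ₂) +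
        512 * 16 * ((Q : ℝ) ^ (-3 + η) * (Q : ℝ) ^ (3 + 3 * η)) * r ^ 2 := by
        rw [← hmax]; ring
    _ ≤ 512 * 16 * 169 * (Q : ℝ) ^ (-3 + η) * (r ^ s * (2 ^ A * (Q : ℝ) ^ A)) +
        512 * 16 * ((Q : ℝ) ^ (-3 + η) * (Q : ℝ) ^ (3 + 3 * η)) *
          (r ^ s * (Q : ℝ) ^ (-(2 - s))) := by
        gcongr
    _ = r ^ s * ((512 * 16 * 169 * 2 ^ A) * (Q : ℝ) ^ (-(3 - A - η)) +
        512 * 16 * (Q : ℝ) ^ (-(2 - s - 4 * η))) := by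
        rw [← hp1, ← hp2]; ring
    _ ≤ r ^ s * ((512 * 16 * 169 * 2 ^ A) * (1 / (2 * (512 * 16 * 169 * 2 ^ A))) +
        512 * 16 * (1 / (2 * (512 * 16)))) := by gcongr
    _ = r ^ s := by
        have : (0 : ℝ) < 2 ^ A := by positivity
        field_simp
        norm_num

/-- The construction starts from a box in the ball. -/
lemma exists_root (c a₁ a₂ : ℝ) {x : Fin 2 → ℝ} {r : ℝ} (hr : 0 < r)
    (hB : Metric.closedBall x r ⊆ {y : Fin 2 → ℝ | ∀ i, y i ∈ Set.Icc (0 : ℝ) 1}) :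
    ∃ (q₀ : ℕ) (L : Level), L.Good c a₁ a₂ q₀ (Metric.closedBall x r) := by
  have hlo : ∀ i, 0 ≤ x i - r := by
    intro i
    have := hB (show (fun j => x j - r) ∈ Metric.closedBall x r by
      rw [mem_closedBall_plane hr.le]
      simp [abs_of_pos hr])
    exact (this i).1
  have hhi : ∀ i, x i + r ≤ 1 := by
    intro i
    have := hB (show (fun j => x j + r) ∈ Metric.closedBall x r by
      rw [mem_closedBall_plane hr.le]
      simp [abs_of_pos hr])
    exact (this i).2
  obtain ⟨T, hT1, hT⟩ := (((powTail_tendsto (a₁ + a₂ - 2)).eventually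
    (gt_mem_nhds (show 0 < r * r / 4096 by positivity))).and
    (Filter.eventually_gt_atTop 0)).exists
  refine ⟨T, ⟨{⟨T, (0, 0)⟩}, fun _ => 1, fun _ => ⟨x 0 - r / 2, r, x 1 - r / 2, r⟩⟩,
    ⟨fun _ _ => zero_le_one, by simp, ?_, ?_, ?_⟩⟩
  · intro P hP
    obtain rfl := Finset.mem_singleton.1 hP
    refine ⟨T, ∅, ⟨?_, ?_, hr, hr, ?_, ?_, hT, le_rfl, hT1.le, by simp, ?_, ?_⟩⟩
    · simp only; linarith [hlo 0]
    · simp only; linarith [hlo 1]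
    · simp only; linarith [hhi 0]
    · simp only; linarith [hhi 1]
    · simp only [Finset.sum_empty]; positivity
    · intro z h1 h2
      exact absurd h2 (not_lt.2 h1)
  · intro P _ y hy
    obtain ⟨⟨h1, h2⟩, h3, h4⟩ := hy
    simp only at h1 h2 h3 h4
    rw [mem_closedBall_plane hr.le, abs_le, abs_le]
    refine ⟨⟨?_, ?_⟩, ?_, ?_⟩ <;> linarith
  · intro P hP z h1 h2
    obtain rfl := Finset.mem_singleton.1 hP
    exact absurd h2 (not_lt.2 h1)

/-- A sequence of successive refinements at rapidly increasing scales. -/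
lemma Level.Good.exists_seq {c a₁ a₂ η : ℝ} (ha : 3 < a₁ + a₂) (h₁ : a₂ ≤ a₁) (h₂ : 1 ≤ a₂)
    (hη : 0 < η) (hη1 : η < 1) (hc0 : 0 ≤ c) (hc₁ : c * 2 ^ a₁ ≤ 1 / 4)
    (hc₂ : c * 2 ^ a₂ ≤ 1 / 4) (hc1 : c ≤ 1) {q₀ : ℕ} {B : Set (Fin 2 → ℝ)} {L₀ : Level}
    (hL : L₀.Good c a₁ a₂ q₀ B) (M : ℕ) :
    ∃ (Q : ℕ → ℕ) (L : ℕ → Level), StrictMono Q ∧ (∀ n, M ≤ Q n) ∧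
      (∀ n, (L n).Good c a₁ a₂ q₀ B) ∧ (∀ n, (L n).AtScale a₁ a₂ η (Q n)) ∧
      ∀ n, (L n).Refines (Q (n + 1)) (L (n + 1)) := by
  have hnext : ∀ st : ℕ × {L : Level // L.Good c a₁ a₂ q₀ B},
      ∃ st' : ℕ × {L : Level // L.Good c a₁ a₂ q₀ B}, st.1 < st'.1 ∧
        st'.2.1.AtScale a₁ a₂ η st'.1 ∧ st.2.1.Refines st'.1 st'.2.1 := by
    rintro ⟨n, L, hL⟩
    obtain ⟨Q, hQ, L', hL', hLQ, hLL⟩ := Filter.frequently_atTop.1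
      (hL.exists_next ha h₁ h₂ hη hη1 hc0 hc₁ hc₂ hc1) (n + 1)
    exact ⟨⟨Q, L', hL'⟩, hQ, hLQ, hLL⟩
  choose f hf1 hf2 hf3 using hnext
  set st : ℕ → ℕ × {L : Level // L.Good c a₁ a₂ q₀ B} := fun n => f^[n] (M, ⟨L₀, hL⟩) with hst
  have hsucc : ∀ n, st (n + 1) = f (st n) := fun n => Function.iterate_succ_apply' f n _
  have hmono : StrictMono fun n => (st n).1 := strictMono_nat_of_lt_succ fun n => by
    simp only [hsucc]; exact hf1 _
  refine ⟨fun n => (st (n + 1)).1, fun n => (st (n + 1)).2.1, ?_, ?_, ?_, ?_, ?_⟩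
  · exact fun m n h => hmono (Nat.add_lt_add_right h 1)
  · intro n
    exact hmono.monotone (Nat.zero_le (n + 1))
  · intro n
    exact (st (n + 1)).2.2
  · intro n
    simp only [hsucc n]
    exact hf2 _
  · intro n
    simp only [hsucc (n + 1)]
    exact hf3 _

lemma Level.Good.mass_le_one {c a₁ a₂ : ℝ} {q₀ : ℕ} {B : Set (Fin 2 → ℝ)} {L : Level}
    (hL : L.Good c a₁ a₂ q₀ B) (U : Set (Fin 2 → ℝ)) : L.mass U ≤ 1 := by
  rw [← hL.sum_one]
  apply Finset.sum_le_sum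
  intro P hP
  refine mul_le_of_le_one_right (hL.nonneg P hP) ?_
  unfold touch; split_ifs <;> norm_num

/-- A set of Hausdorff measure zero is covered by balls with arbitrarily small sum of powers of
radii. -/
lemma exists_balls_of_hausdorffMeasure_eq_zero {X : Type*} [MetricSpace X] [MeasurableSpace X]
    [BorelSpace X] [Nonempty X] {s : ℝ} (hs : 0 < s) {A : Set X}
    (hA : Measure.hausdorffMeasure s A = 0) {δ : ℝ} (hδ : 0 < δ) :
    ∃ (x : ℕ → X) (r : ℕ → ℝ), (∀ n, 0 < r n) ∧ A ⊆ ⋃ n, Metric.ball (x n) (r n) ∧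
      ∀ I : Finset ℕ, ∑ i ∈ I, r i ^ s ≤ δ := by
  rw [Measure.hausdorffMeasure_apply] at hA
  have h1 := ENNReal.iSup_eq_zero.1 (ENNReal.iSup_eq_zero.1 hA 1) one_pos
  have h2 : (⨅ (t : ℕ → Set X) (_ : A ⊆ ⋃ n, t n) (_ : ∀ n, Metric.ediam (t n) ≤ 1),
      ∑' n, ⨆ _ : (t n).Nonempty, Metric.ediam (t n) ^ s) < ENNReal.ofReal (δ / 2) := by
    rw [h1]; exact ENNReal.ofReal_pos.2 (by linarith)
  simp only [iInf_lt_iff] at h2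
  obtain ⟨t, htA, htd, hsum⟩ := h2
  set D : ℕ → ENNReal := fun n => ⨆ _ : (t n).Nonempty, Metric.ediam (t n) ^ s with hD
  have hDn : ∀ n, D n ≠ ⊤ := fun n => ne_top_of_le_ne_top hsum.ne_top (ENNReal.le_tsum n)
  have hball : ∀ n, ∃ (x : X) (r : ℝ), 0 < r ∧ t n ⊆ Metric.ball x r ∧
      r ^ s ≤ (D n).toReal + δ / 4 * (1 / 2) ^ n := by
    intro n
    have he : 0 < δ / 4 * (1 / 2) ^ n := by positivity
    have hnt : Metric.ediam (t n) ≠ ⊤ := ne_top_of_le_ne_top ENNReal.one_ne_top (htd n)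
    have hcont : ContinuousAt (fun ρ : ℝ => ρ ^ s) (Metric.diam (t n)) :=
      Real.continuousAt_rpow_const _ _ (Or.inr hs.le)
    have hev : ∀ᶠ ρ in nhdsWithin (Metric.diam (t n)) (Ioi (Metric.diam (t n))),
        ρ ^ s < Metric.diam (t n) ^ s + δ / 4 * (1 / 2) ^ n :=
      (hcont.eventually (gt_mem_nhds (by linarith))).filter_mono nhdsWithin_le_nhds
    obtain ⟨ρ, hρ, hρd⟩ := (hev.and self_mem_nhdsWithin).exists
    have hρd' : Metric.diam (t n) < ρ := hρd
    have hρ0 : 0 < ρ := lt_of_le_of_lt Metric.diam_nonneg hρd'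
    by_cases hne : (t n).Nonempty
    · obtain ⟨x, hx⟩ := hne
      refine ⟨x, ρ, hρ0, fun y hy => ?_, ?_⟩
      · rw [Metric.mem_ball]
        refine lt_of_le_of_lt ?_ hρd'
        exact Metric.dist_le_diam_of_mem (Metric.isBounded_iff_ediam_ne_top.2 hnt) hy hx
      · have : (D n).toReal = Metric.diam (t n) ^ s := by
          have hDx : D n = Metric.ediam (t n) ^ s := by
            rw [hD]
            exact iSup_pos ⟨x, hx⟩
          rw [hDx, ← ENNReal.toReal_rpow]
          rfl
        rw [this]
        exact hρ.le
    · rw [not_nonempty_iff_eq_empty] at hne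
      rw [hne, Metric.diam_empty, Real.zero_rpow hs.ne', zero_add] at hρ
      refine ⟨Classical.arbitrary X, ρ, hρ0, by rw [hne]; exact empty_subset _, ?_⟩
      have : 0 ≤ (D n).toReal := ENNReal.toReal_nonneg
      linarith
  choose x r hr htr hrs using hball
  refine ⟨x, r, hr, htA.trans (iUnion_mono htr), fun I => ?_⟩
  have hDsum : ∑ i ∈ I, (D i).toReal ≤ δ / 2 := by
    rw [← ENNReal.toReal_sum fun i _ => hDn i]
    apply ENNReal.toReal_le_of_le_ofReal (by linarith)
    exact (ENNReal.sum_le_tsum I).trans hsum.le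
  have hgeo : ∑ i ∈ I, ((1 : ℝ) / 2) ^ i ≤ 2 :=
    (summable_geometric_two.sum_le_tsum I fun i _ => by positivity).trans tsum_geometric_two.le
  calc ∑ i ∈ I, r i ^ s ≤ ∑ i ∈ I, ((D i).toReal + δ / 4 * (1 / 2) ^ i) :=
        Finset.sum_le_sum fun i _ => hrs i
    _ = ∑ i ∈ I, (D i).toReal + δ / 4 * ∑ i ∈ I, ((1 : ℝ) / 2) ^ i := by
        rw [Finset.sum_add_distrib, Finset.mul_sum]
    _ ≤ δ / 2 + δ / 4 * 2 := by gcongr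
    _ = δ := by ring

lemma Box.isCompact_toSet (R : Box) : IsCompact R.toSet := by
  have h : R.toSet = Set.Icc ![R.b₁, R.b₂] ![R.b₁ + R.l₁, R.b₂ + R.l₂] := by
    ext y
    simp only [Box.toSet, mem_ofPred_eq, Set.mem_Icc, Pi.le_def, Fin.forall_fin_two,
      Matrix.cons_val_zero, Matrix.cons_val_one]
    tauto
  rw [h]
  exact isCompact_Icc

/-- The union of the boxes of a level. -/
def Level.region (L : Level) : Set (Fin 2 → ℝ) := ⋃ P ∈ L.S, (L.box P).toSet

lemma Level.isCompact_region (L : Level) : IsCompact L.region :=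
  L.S.isCompact_biUnion fun P _ => (L.box P).isCompact_toSet

/-- The mass distribution principle for a sequence of levels. -/
lemma hausdorffMeasure_iInter_region_ne_zero {c a₁ a₂ : ℝ} {q₀ : ℕ} {B : Set (Fin 2 → ℝ)}
    {Q : ℕ → ℕ} {L : ℕ → Level} (hQ : StrictMono Q) (hL : ∀ n, (L n).Good c a₁ a₂ q₀ B)
    (hLL : ∀ n, (L n).Refines (Q (n + 1)) (L (n + 1))) {s C : ℝ} (hs : 0 < s) (hC : 0 < C)
    (hmass : ∀ n (x : Fin 2 → ℝ) (r : ℝ), 0 < r → 1 / (Q n : ℝ) ≤ r →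
      (L n).mass (Metric.closedBall x r) ≤ C * r ^ s) :
    Measure.hausdorffMeasure s (⋂ n, (L n).region) ≠ 0 := by
  intro h0
  obtain ⟨x, r, hr, hcov, hsum⟩ := exists_balls_of_hausdorffMeasure_eq_zero hs h0
    (δ := 1 / (2 * C)) (by positivity)
  have hanti : Antitone fun n => (L n).region := by
    apply antitone_nat_of_succ_le
    intro n y hy
    simp only [Level.region, mem_iUnion] at hy ⊢
    obtain ⟨X, hX, hyX⟩ := hy
    obtain ⟨P, hP, hXP⟩ := (hLL n).subset X hX
    exact ⟨P, hP, hXP hyX⟩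
  obtain ⟨n₀, hn₀⟩ := exists_subset_nhds_of_isCompact' (V := fun n => (L n).region)
    hanti.directed_ge (fun n => (L n).isCompact_region)
    (fun n => (L n).isCompact_region.isClosed) (U := ⋃ n, Metric.ball (x n) (r n))
    (fun y hy => (isOpen_iUnion fun n => Metric.isOpen_ball).mem_nhds (hcov hy))
  obtain ⟨I, hI⟩ := (L n₀).isCompact_region.elim_finite_subcover _
    (fun n => Metric.isOpen_ball) hn₀
  have hQt : Filter.Tendsto (fun n => 1 / (Q n : ℝ)) Filter.atTop (nhds 0) :=
    tendsto_one_div_atTop_nhds_zero_nat.comp hQ.tendsto_atTop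
  have hev : ∀ᶠ n in Filter.atTop, ∀ i ∈ I, 1 / (Q n : ℝ) < r i := by
    rw [Filter.eventually_all_finset]
    exact fun i _ => hQt.eventually (gt_mem_nhds (hr i))
  obtain ⟨n, hn, hnn₀⟩ := (hev.and (Filter.eventually_ge_atTop n₀)).exists
  have htouch : ∀ P ∈ (L n).S,
      1 ≤ ∑ i ∈ I, touch ((L n).box P) (Metric.closedBall (x i) (r i)) := by
    intro P hP
    obtain ⟨T, N, hf⟩ := (hL n).fertile P hP
    set y : Fin 2 → ℝ := ![((L n).box P).b₁, ((L n).box P).b₂]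
    have hy : y ∈ ((L n).box P).toSet :=
      ⟨⟨le_rfl, by simpa [y] using hf.l₁_pos.le⟩, le_rfl, by simpa [y] using hf.l₂_pos.le⟩
    have hyI := hI (hanti hnn₀ (mem_biUnion hP hy))
    simp only [mem_iUnion] at hyI
    obtain ⟨i, hi, hyi⟩ := hyI
    have hne : (((L n).box P).toSet ∩ Metric.closedBall (x i) (r i)).Nonempty :=
      ⟨y, hy, Metric.ball_subset_closedBall hyi⟩
    rw [← touch_of_nonempty hne]
    exact Finset.single_le_sum
      (f := fun i => touch ((L n).box P) (Metric.closedBall (x i) (r i)))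
      (fun i _ => touch_nonneg _ _) hi
  have : (1 : ℝ) ≤ 1 / 2 := by
    calc (1 : ℝ) = ∑ P ∈ (L n).S, (L n).m P * 1 := by simp [(hL n).sum_one]
      _ ≤ ∑ P ∈ (L n).S, (L n).m P *
          ∑ i ∈ I, touch ((L n).box P) (Metric.closedBall (x i) (r i)) := by
          gcongr with P hP
          · exact (hL n).nonneg P hP
          · exact htouch P hP
      _ = ∑ i ∈ I, (L n).mass (Metric.closedBall (x i) (r i)) := by
          simp_rw [Level.mass, Finset.mul_sum]
          rw [Finset.sum_comm]
      _ ≤ ∑ i ∈ I, C * r i ^ s :=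
          Finset.sum_le_sum fun i hi => hmass n _ _ (hr i) (hn i hi).le
      _ = C * ∑ i ∈ I, r i ^ s := by rw [Finset.mul_sum]
      _ ≤ C * (1 / (2 * C)) := by gcongr; exact hsum I
      _ = 1 / 2 := by field_simp
  norm_num at this

/-- The points in all regions of a sequence of levels are weighted badly approximable. -/
lemma iInter_region_subset_badSet {c τ₁ τ₂ η : ℝ} (h₁ : 0 < 1 + τ₁) (h₂ : 0 < 1 + τ₂) (hc0 : 0 < c)
    (hc1 : c < 1) {q₀ : ℕ} {B : Set (Fin 2 → ℝ)}
    (hB : B ⊆ {y : Fin 2 → ℝ | ∀ i, y i ∈ Set.Icc (0 : ℝ) 1})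
    {Q : ℕ → ℕ} {L : ℕ → Level} (hQ : StrictMono Q) (hQ0 : ∀ n, 0 < Q n)
    (hL : ∀ n, (L n).Good c (1 + τ₁) (1 + τ₂) q₀ B)
    (hLQ : ∀ n, (L n).AtScale (1 + τ₁) (1 + τ₂) η (Q n)) :
    ⋂ n, (L n).region ⊆ B ∩ badSet 2 (psiTau 2 ![τ₁, τ₂]) := by
  intro x hx
  rw [mem_iInter] at hx
  have hx' : ∀ n, ∃ P ∈ (L n).S, x ∈ ((L n).box P).toSet := by
    intro n
    have := hx n
    simp only [Level.region, mem_iUnion] at this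
    obtain ⟨P, hP, h⟩ := this
    exact ⟨P, hP, h⟩
  choose P hP hxP using hx'
  have hxB : x ∈ B := (hL 0).subset _ (hP 0) (hxP 0)
  have hmul : ∀ (q : ℕ) (τ : ℝ), 0 < q → (q : ℝ) * (q : ℝ) ^ (-(1 + τ)) = (q : ℝ) ^ (-τ) := by
    intro q τ hq
    have hq' : (0 : ℝ) < q := by exact_mod_cast hq
    nth_rewrite 1 [← Real.rpow_one (q : ℝ)]
    rw [← Real.rpow_add hq']
    congr 1; ring
  have hscale : ∀ (q : ℕ) (p : ℤ) (v : ℝ), 0 < q →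
      |(q : ℝ) * v - p| = q * |v - p / q| := by
    intro q p v hq
    have hq' : (0 : ℝ) < q := by exact_mod_cast hq
    rw [← abs_of_pos hq', ← abs_mul, abs_of_pos hq', mul_sub, mul_div_cancel₀ _ hq'.ne']
  refine ⟨hxB, ⟨hB hxB, ?_⟩, ?_⟩
  · rw [Set.infinite_iff_exists_gt]
    intro a
    have hQa : a ≤ Q a := hQ.id_le a
    obtain ⟨⟨hq1, hq2⟩, hqp⟩ := mem_dyadicPrimes.1 ((hLQ a).mem _ (hP a))
    refine ⟨(P a).1, ⟨hqp.pos, ![(P a).2.1, (P a).2.2], ?_⟩, by omega⟩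
    have hxb := hxP a
    rw [(hLQ a).box_eq _ (hP a)] at hxb
    obtain ⟨⟨h3, h4⟩, h5, h6⟩ := mem_childBox.1 hxb
    have hq0 : (0 : ℝ) < (P a).1 := by exact_mod_cast hqp.pos
    have w₁ := width_pos (1 + τ₁) (hQ0 a)
    have w₂ := width_pos (1 + τ₂) (hQ0 a)
    have w₁' := width_le_rpow h₁ hqp.pos hq2
    have w₂' := width_le_rpow h₂ hqp.pos hq2
    rw [Fin.forall_fin_two]
    simp only [psiTau, Matrix.cons_val_zero, Matrix.cons_val_one]
    rw [hscale _ _ _ hqp.pos, hscale _ _ _ hqp.pos, ← hmul _ τ₁ hqp.pos, ← hmul _ τ₂ hqp.pos]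
    constructor
    · apply mul_lt_mul_of_pos_left _ hq0
      rw [abs_lt]; constructor <;> linarith
    · apply mul_lt_mul_of_pos_left _ hq0
      rw [abs_lt]; constructor <;> linarith
  · intro hall
    rw [mem_iInter₂] at hall
    have hinf := (hall c ⟨hc0, hc1⟩).2
    obtain ⟨q, ⟨hq0, p, hp⟩, hqq⟩ := hinf.exists_gt q₀
    have hq0' : (0 : ℝ) < q := by exact_mod_cast hq0
    have hQq : q ≤ Q q := hQ.id_le q
    have hlt : q < (P q).1 :=
      lt_of_le_of_lt hQq (mem_dyadicPrimes.1 ((hLQ q).mem _ (hP q))).1.1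
    refine (hL q).avoid _ (hP q) ⟨q, (p 0, p 1)⟩ hqq.le hlt x (hxP q) ?_
    rw [Fin.forall_fin_two] at hp
    simp only [psiTau, Matrix.cons_val_zero, Matrix.cons_val_one] at hp
    rw [hscale _ _ _ hq0, hscale _ _ _ hq0, ← hmul _ τ₁ hq0, ← hmul _ τ₂ hq0] at hp
    constructor
    · refine lt_of_mul_lt_mul_left ?_ hq0'.le
      calc _ < _ := hp.1
        _ = _ := by ring
    · refine lt_of_mul_lt_mul_left ?_ hq0'.le
      calc _ < _ := hp.2
        _ = _ := by ring

/-- Given exponents `α + β = s` for which the covering estimates apply, every ball contains a subset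
of the badly approximable set of dimension at least `s`. -/
lemma exists_subset_badSet_le_dimH {τ₁ τ₂ α β s : ℝ} (hτ : τ₂ ≤ τ₁) (hτ₂ : 0 < τ₂)
    (hsum : 1 < τ₁ + τ₂) {x : Fin 2 → ℝ} {r : ℝ} (hr : 0 < r)
    (hB : Metric.closedBall x r ⊆ {y : Fin 2 → ℝ | ∀ i, y i ∈ Set.Icc (0 : ℝ) 1})
    (hα0 : 0 ≤ α) (hα1 : α ≤ 1) (hβ0 : 0 ≤ β) (hβ1 : β ≤ 1) (hs : α + β = s) (hs0 : 0 < s)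
    (hs2 : s < 2) (hA : (1 + τ₁) * α + (1 + τ₂) * β < 3) :
    ∃ D ⊆ Metric.closedBall x r ∩ badSet 2 (psiTau 2 ![τ₁, τ₂]),
      ENNReal.ofReal s ≤ dimH D := by
  obtain ⟨η, hη0, hη⟩ := exists_between (show (0 : ℝ) <
    min (min (3 - ((1 + τ₁) * α + (1 + τ₂) * β)) ((2 - s) / 4)) 1 from
      lt_min (lt_min (by linarith) (by linarith)) one_pos)
  obtain ⟨⟨hη3, hη2⟩, hη1⟩ : (η < 3 - ((1 + τ₁) * α + (1 + τ₂) * β) ∧ η < (2 - s) / 4) ∧ η < 1 := by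
    simpa only [lt_min_iff] using hη
  set c : ℝ := (2 : ℝ) ^ (-(1 + τ₁)) / 4 with hc
  have hpow : (2 : ℝ) ^ (-(1 + τ₁)) * 2 ^ (1 + τ₁) = 1 := by
    rw [← Real.rpow_add two_pos]; simp
  have hc0 : 0 < c := by positivity
  have hc₁ : c * 2 ^ (1 + τ₁) ≤ 1 / 4 := by
    rw [hc]; linarith
  have hc₂ : c * 2 ^ (1 + τ₂) ≤ 1 / 4 := by
    refine le_trans ?_ hc₁
    gcongr
    norm_num
  have hc1 : c < 1 := by
    have : (2 : ℝ) ^ (-(1 + τ₁)) ≤ 1 :=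
      Real.rpow_le_one_of_one_le_of_nonpos one_le_two (by linarith)
    rw [hc]; linarith
  obtain ⟨q₀, L₀, hL₀⟩ := exists_root c (1 + τ₁) (1 + τ₂) hr hB
  obtain ⟨M, hM⟩ := Filter.eventually_atTop.1 (eventually_mass_ball_le (c := c) (a₁ := 1 + τ₁)
    (a₂ := 1 + τ₂) (η := η) hα0 hα1 hβ0 hβ1 hs (by linarith) (by linarith) q₀
    (Metric.closedBall x r))
  obtain ⟨Q, L, hQ, hQM, hL, hLQ, hLL⟩ := Level.Good.exists_seq (by linarith) (by linarith)
    (by linarith) hη0 hη1 hc0.le hc₁ hc₂ hc1.le hL₀ (max M 1)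
  have hQ0 : ∀ n, 0 < Q n := fun n => lt_of_lt_of_le (by simp) (hQM n)
  have hQ1 : (1 : ℝ) ≤ (Q 0 : ℝ) ^ s :=
    Real.one_le_rpow (by exact_mod_cast hQ0 0) hs0.le
  have hmass : ∀ n (y : Fin 2 → ℝ) (ρ : ℝ), 0 < ρ → 1 / (Q n : ℝ) ≤ ρ →
      (L n).mass (Metric.closedBall y ρ) ≤ (Q 0 : ℝ) ^ s * ρ ^ s := by
    intro n
    induction n with
    | zero =>
      intro y ρ hρ h
      have hq : (0 : ℝ) < Q 0 := by exact_mod_cast hQ0 0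
      refine ((hL 0).mass_le_one _).trans ?_
      rw [← Real.mul_rpow hq.le hρ.le]
      refine Real.one_le_rpow ?_ hs0.le
      rw [div_le_iff₀ hq] at h
      linarith
    | succ n ih =>
      intro y ρ hρ h
      rcases le_total (1 / (Q n : ℝ)) ρ with h' | h'
      · exact ((hLL n).mass_le _).trans (ih y ρ hρ h')
      · refine (hM (Q n) ((le_max_left _ _).trans (hQM n)) (L n) (L (n + 1)) (Q (n + 1)) (hL n)
          (hLQ n) (hLL n) y ρ hρ h h').trans ?_
        exact le_mul_of_one_le_left (by positivity) hQ1
  refine ⟨⋂ n, (L n).region, iInter_region_subset_badSet (by linarith) (by linarith) hc0 hc1 hB hQ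
    hQ0 hL hLQ, ?_⟩
  refine le_dimH_of_hausdorffMeasure_ne_zero (d := s.toNNReal) ?_
  rw [Real.coe_toNNReal _ hs0.le]
  exact hausdorffMeasure_iInter_region_ne_zero hQ hL hLL hs0 (by positivity) hmass

/-- for `τ1 ≥ τ2 > 0`, `τ1 + τ2 > 1`, any ball `B ⊆ [0,1]²` of positive radius,
any `ε > 0`, and any rational `ρ = (ρ1, ρ2)` with `ρ1, ρ2 ≥ 1`, `ρ1 + ρ2 = 3`, `ρ1 ≥ ρ2`,
`1 + τᵢ - ρᵢ > 0`, there is a subset `D ⊆ B ∩ B_2(Ψ_τ)` with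
`dim_H D ≥ min{(3+τ1-τ2)/(1+τ1), 3/(1+τ2), 1 + ρ2/(1+τ2)} - 2ε`. -/
theorem stmt1 (τ1 τ2 : ℝ) (hτ : τ2 ≤ τ1) (hτ2 : 0 < τ2) (hsum : 1 < τ1 + τ2)
    (x : Fin 2 → ℝ) (r : ℝ) (hr : 0 < r)
    (hB : Metric.closedBall x r ⊆ {y : Fin 2 → ℝ | ∀ i, y i ∈ Set.Icc (0:ℝ) 1})
    (ε : ℝ) (hε : 0 < ε)
    (ρ1 ρ2 : ℚ) (hρ1 : 1 ≤ ρ1) (hρ2 : 1 ≤ ρ2) (hρsum : ρ1 + ρ2 = 3) (hρ : ρ2 ≤ ρ1)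
    (h1 : 0 < 1 + τ1 - (ρ1 : ℝ)) (h2 : 0 < 1 + τ2 - (ρ2 : ℝ)) :
    ∃ D ⊆ Metric.closedBall x r ∩ badSet 2 (psiTau 2 ![τ1, τ2]),
      ENNReal.ofReal
        (min (min ((3 + τ1 - τ2) / (1 + τ1)) (3 / (1 + τ2))) (1 + (ρ2 : ℝ) / (1 + τ2))
          - 2 * ε) ≤ dimH D := by
  set s : ℝ := min (min ((3 + τ1 - τ2) / (1 + τ1)) (3 / (1 + τ2))) (1 + (ρ2 : ℝ) / (1 + τ2))
    - 2 * ε with hs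
  rcases le_or_gt s 0 with hs0 | hs0
  · exact ⟨∅, empty_subset _, by simp [ENNReal.ofReal_of_nonpos hs0]⟩
  have hs₁ : s * (1 + τ1) < 3 + τ1 - τ2 := by
    rw [← lt_div_iff₀ (by linarith)]
    have := (min_le_left (min ((3 + τ1 - τ2) / (1 + τ1)) (3 / (1 + τ2)))
      (1 + (ρ2 : ℝ) / (1 + τ2))).trans (min_le_left _ _)
    linarith
  have hs₂ : s * (1 + τ2) < 3 := by
    rw [← lt_div_iff₀ (by linarith)]
    have := (min_le_left (min ((3 + τ1 - τ2) / (1 + τ1)) (3 / (1 + τ2)))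
      (1 + (ρ2 : ℝ) / (1 + τ2))).trans (min_le_right _ _)
    linarith
  have hs2 : s < 2 := by nlinarith
  rcases le_total s 1 with h | h
  · exact exists_subset_badSet_le_dimH hτ hτ2 hsum hr hB (α := 0) (β := s) le_rfl zero_le_one hs0.le
      h (zero_add s) hs0 hs2 (by linarith)
  · exact exists_subset_badSet_le_dimH hτ hτ2 hsum hr hB (α := s - 1) (β := 1) (by linarith)
      (by linarith) zero_le_one le_rfl (by ring) hs0 hs2 (by linarith)
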